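/- arXiv:math/0310058 — 8 statements merged into one kernel-verified Lean document; each statement's English description precedes it below -/
import Mathlib

section
/- Let X : ℝ² × ℝ → ℝ² be twice continuously differentiable with div_z X(z,t) = 0 for all (z,t), and let ω(z,t) := curl_z X(z,t). Then for every (z,t), the scalar curl in the space variable of the vector field w ↦ ∂_t X(w,t) + D_zX(w,t)(X(w,t)) evaluated at z equals ∂_t ω(z,t) + ⟨∇_z ω(z,t), X(z,t)⟩. -/
open MeasureTheory
open scoped ENNReal RealInnerProductSpace

noncomputable section

/-- The Euclidean plane. -/
abbrev E2 := EuclideanSpace ℝ (Fin 2)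

/-- Divergence of a planar vector field: `div Y = ∂₁Y₁ + ∂₂Y₂`. -/
def div2 (Y : E2 → E2) (z : E2) : ℝ :=
  fderiv ℝ Y z (EuclideanSpace.single 0 1) 0 + fderiv ℝ Y z (EuclideanSpace.single 1 1) 1

/-- Scalar curl of a planar vector field: `curl Y = ∂₁Y₂ − ∂₂Y₁`. -/
def curl2 (Y : E2 → E2) (z : E2) : ℝ :=
  fderiv ℝ Y z (EuclideanSpace.single 0 1) 1 - fderiv ℝ Y z (EuclideanSpace.single 1 1) 0

/-- The rotation `J(a, b) = (b, −a)`. -/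
def J2 (v : E2) : E2 := (WithLp.equiv 2 (Fin 2 → ℝ)).symm ![v 1, -v 0]

section PartialDerivatives

variable {E F G : Type*} [NormedAddCommGroup E] [NormedSpace ℝ E]
  [NormedAddCommGroup F] [NormedSpace ℝ F] [NormedAddCommGroup G] [NormedSpace ℝ G]

lemma HasFDerivAt.comp_prodMk_left {f : E × F → G} {x : E} {y : F} {f' : E × F →L[ℝ] G}
    (hf : HasFDerivAt f f' (x, y)) :
    HasFDerivAt (fun u => f (u, y)) (f'.comp (ContinuousLinearMap.inl ℝ E F)) x :=
  hf.comp x (hasFDerivAt_prodMk_left x y)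

lemma HasFDerivAt.hasDerivAt_comp_prodMk_right {f : E × ℝ → G} {x : E} {t : ℝ}
    {f' : E × ℝ →L[ℝ] G} (hf : HasFDerivAt f f' (x, t)) :
    HasDerivAt (fun τ => f (x, τ)) (f' (0, 1)) t :=
  hf.comp_hasDerivAt t ((hasDerivAt_const t x).prodMk (hasDerivAt_id t))

end PartialDerivatives

/-- The bilinear identity `curl (A²) = tr A · curl A` for a linear planar field `A`. -/
lemma curl_comp_self_of_linear (A : E2 →L[ℝ] E2) :
    A (A (EuclideanSpace.single 0 1)) 1 - A (A (EuclideanSpace.single 1 1)) 0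
      = (A (EuclideanSpace.single 0 1) 0 + A (EuclideanSpace.single 1 1) 1)
        * (A (EuclideanSpace.single 0 1) 1 - A (EuclideanSpace.single 1 1) 0) := by
  have expand (v : E2) : A v
      = v 0 • A (EuclideanSpace.single 0 1) + v 1 • A (EuclideanSpace.single 1 1) := by
    rw [← map_smul, ← map_smul, ← map_add]
    congr 1
    ext i
    fin_cases i <;> simp
  rw [expand (A (EuclideanSpace.single 0 1)), expand (A (EuclideanSpace.single 1 1))]
  simp only [PiLp.add_apply, PiLp.smul_apply, smul_eq_mul]
  ring

/-- For a `C²` divergence-free time-dependent planar field `X` with vorticity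
`ω(z,t) = curl_z X(z,t)`, one has
`curl_z (∂_t X + D_zX(X))(z,t) = ∂_t ω(z,t) + ⟨∇_z ω(z,t), X(z,t)⟩`. -/
theorem stmt_1 (X : E2 × ℝ → E2) (hX : ContDiff ℝ 2 X)
    (hdiv : ∀ z t, div2 (fun w => X (w, t)) z = 0) (z : E2) (t : ℝ) :
    curl2 (fun w => deriv (fun τ => X (w, τ)) t
        + fderiv ℝ (fun u => X (u, t)) w (X (w, t))) z
      = deriv (fun τ => curl2 (fun w => X (w, τ)) z) t
        + ⟪gradient (fun w => curl2 (fun u => X (u, t)) w) z, X (z, t)⟫ := by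
  have hX' (p : E2 × ℝ) : HasFDerivAt X (fderiv ℝ X p) p :=
    (hX.differentiable (by norm_num) p).hasFDerivAt
  have hDX : HasFDerivAt (fderiv ℝ X) (fderiv ℝ (fderiv ℝ X) (z, t)) (z, t) :=
    ((hX.fderiv_right (m := 1) (by norm_num)).differentiable (by norm_num) _).hasFDerivAt
  have hsymm : IsSymmSndFDerivAt ℝ X (z, t) :=
    hX.contDiffAt.isSymmSndFDerivAt (by simp)
  have hspace (w : E2) (s : ℝ) : fderiv ℝ (fun u => X (u, s)) w
      = (fderiv ℝ X (w, s)).comp (ContinuousLinearMap.inl ℝ E2 ℝ) :=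
    (hX' (w, s)).comp_prodMk_left.fderiv
  have htime (w : E2) (s : ℝ) : deriv (fun τ => X (w, τ)) s = fderiv ℝ X (w, s) (0, 1) :=
    (hX' (w, s)).hasDerivAt_comp_prodMk_right.deriv
  have hcurl (w : E2) (s : ℝ) : curl2 (fun u => X (u, s)) w
      = fderiv ℝ X (w, s) (EuclideanSpace.single 0 1, 0) 1
        - fderiv ℝ X (w, s) (EuclideanSpace.single 1 1, 0) 0 := by
    simp [curl2, hspace]
  have hω : HasFDerivAt
      (fun p : E2 × ℝ => fderiv ℝ X p (EuclideanSpace.single 0 1, 0) 1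
        - fderiv ℝ X p (EuclideanSpace.single 1 1, 0) 0)
      (((EuclideanSpace.proj 1 : E2 →L[ℝ] ℝ).comp
          ((fderiv ℝ (fderiv ℝ X) (z, t)).flip (EuclideanSpace.single 0 1, 0)))
        - (EuclideanSpace.proj 0 : E2 →L[ℝ] ℝ).comp
          ((fderiv ℝ (fderiv ℝ X) (z, t)).flip (EuclideanSpace.single 1 1, 0))) (z, t) := by
    have happly (v : E2 × ℝ) : HasFDerivAt (fun p => fderiv ℝ X p v)
        ((fderiv ℝ (fderiv ℝ X) (z, t)).flip v) (z, t) := by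
      simpa using hDX.clm_apply (hasFDerivAt_const v (z, t))
    exact ((EuclideanSpace.proj 1 : E2 →L[ℝ] ℝ).hasFDerivAt.comp _ (happly _)).sub
      ((EuclideanSpace.proj 0 : E2 →L[ℝ] ℝ).hasFDerivAt.comp _ (happly _))
  have hmaterial : HasFDerivAt
      (fun w => fderiv ℝ X (w, t) (0, 1) + fderiv ℝ X (w, t) (X (w, t), 0)) _ z :=
    (hDX.comp_prodMk_left.clm_apply (hasFDerivAt_const (0, 1) z)).add
      (hDX.comp_prodMk_left.clm_apply
        ((hX' (z, t)).comp_prodMk_left.prodMk (hasFDerivAt_const 0 z)))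
  have hquad := curl_comp_self_of_linear
    ((fderiv ℝ X (z, t)).comp (ContinuousLinearMap.inl ℝ E2 ℝ))
  have hdiv' := hdiv z t
  rw [div2, hspace] at hdiv'
  rw [hdiv', zero_mul] at hquad
  simp only [hcurl, hω.hasDerivAt_comp_prodMk_right.deriv, gradient,
    InnerProductSpace.toDual_symm_apply, hω.comp_prodMk_left.fderiv]
  simp only [curl2, hspace, htime, ContinuousLinearMap.comp_apply, ContinuousLinearMap.inl_apply,
    hmaterial.fderiv]
  simp only [ContinuousLinearMap.comp_apply, ContinuousLinearMap.inl_apply] at hquad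
  simp
  rw [hsymm.eq (0, 1), hsymm.eq (0, 1), hsymm.eq (X (z, t), 0), hsymm.eq (X (z, t), 0)]
  linarith
end
end

section
/- Let X : ℝ² × ℝ → ℝ² be continuously differentiable, let φ : ℝ² × ℝ → ℝ² be twice continuously differentiable with φ(z,0) = z and ∂_t φ(z,t) = X(φ(z,t),t) for all (z,t), and let γ : [0,1] → ℝ² be a C¹ curve with γ(0) = γ(1). Define c(t) := ∫₀¹ ⟨X(φ(γ(s),t), t), ∂_s[φ(γ(s),t)]⟩ ds. Then c is differentiable and for every t, c'(t) = ∫₀¹ ⟨∂_t X(φ(γ(s),t),t) + D_zX(φ(γ(s),t),t)(X(φ(γ(s),t),t)), ∂_s[φ(γ(s),t)]⟩ ds. -/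
open MeasureTheory
open scoped ENNReal RealInnerProductSpace

noncomputable section

/-- Differentiation under the integral sign over a compact interval, for an integrand whose
partial derivative in the parameter is jointly continuous. -/
theorem hasDerivAt_intervalIntegral_of_continuous_deriv {F F' : ℝ → ℝ → ℝ} {a b : ℝ}
    (hF : ∀ t, Continuous (F t)) (hF' : Continuous fun p : ℝ × ℝ => F' p.1 p.2)
    (hd : ∀ t s, HasDerivAt (fun τ => F τ s) (F' t s) t) (t : ℝ) :
    HasDerivAt (fun τ => ∫ s in a..b, F τ s) (∫ s in a..b, F' t s) t := by
  obtain ⟨C, hC⟩ := ((isCompact_closedBall t 1).prod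
    (isCompact_uIcc (a := a) (b := b))).exists_bound_of_continuousOn hF'.continuousOn
  have hslice : Continuous (F' t) := hF'.comp (by fun_prop : Continuous fun s : ℝ => (t, s))
  refine (intervalIntegral.hasDerivAt_integral_of_dominated_loc_of_deriv_le
    (bound := fun _ => C) (Metric.closedBall_mem_nhds t one_pos)
    (Filter.Eventually.of_forall fun τ => (hF τ).aestronglyMeasurable)
    ((hF t).intervalIntegrable a b) hslice.aestronglyMeasurable
    (Filter.Eventually.of_forall fun s hs τ hτ => ?_) intervalIntegrable_const
    (Filter.Eventually.of_forall fun s _ τ _ => hd τ s)).2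
  exact hC (τ, s) ⟨hτ, Set.uIoc_subset_uIcc hs⟩

section Flow

variable {E : Type*} [NormedAddCommGroup E] [InnerProductSpace ℝ E]

/-- The velocity of a curve transported by `f`. -/
theorem hasDerivAt_comp_curve {f : E × ℝ → E} {γ : ℝ → E} (hf : Differentiable ℝ f)
    (hγ : Differentiable ℝ γ) (s t : ℝ) :
    HasDerivAt (fun u => f (γ u, t)) (fderiv ℝ f (γ s, t) (deriv γ s, 0)) s :=
  (hf (γ s, t)).hasFDerivAt.comp_hasDerivAt s
    ((hγ s).hasDerivAt.prodMk (hasDerivAt_const s t))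

theorem hasDerivAt_comp_time {F : Type*} [NormedAddCommGroup F] [NormedSpace ℝ F]
    {f : E × ℝ → F} (hf : Differentiable ℝ f) (z : E) (t : ℝ) :
    HasDerivAt (fun τ => f (z, τ)) (fderiv ℝ f (z, t) (0, 1)) t :=
  (hf (z, t)).hasFDerivAt.comp_hasDerivAt t ((hasDerivAt_const t z).prodMk (hasDerivAt_id t))

/-- The time derivative of a vector transported by the linearized flow. -/
theorem hasDerivAt_fderiv_flow {φ G : E × ℝ → E} (hφ : ContDiff ℝ 2 φ)
    (hflow : ∀ z t, HasDerivAt (fun τ => φ (z, τ)) (G (z, t)) t) (z v : E) (t : ℝ) :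
    HasDerivAt (fun τ => fderiv ℝ φ (z, τ) (v, 0)) (fderiv ℝ G (z, t) (v, 0)) t := by
  have hD : Differentiable ℝ (fderiv ℝ φ) :=
    (hφ.fderiv_right (m := 1) (by norm_num)).differentiable one_ne_zero
  have hG : G = fun p => fderiv ℝ φ p (0, 1) := by
    funext ⟨w, τ⟩
    exact (hflow w τ).unique (hasDerivAt_comp_time (hφ.differentiable two_ne_zero) w τ)
  have hGd : fderiv ℝ G (z, t) (v, 0) = fderiv ℝ (fderiv ℝ φ) (z, t) (v, 0) (0, 1) := by
    rw [hG, fderiv_clm_apply (hD _) (differentiableAt_const _)]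
    simp
  have hsymm : IsSymmSndFDerivAt ℝ φ (z, t) :=
    hφ.contDiffAt.isSymmSndFDerivAt (by simp)
  rw [hGd, hsymm.eq]
  have hline : HasDerivAt (fun τ => fderiv ℝ φ (z, τ)) (fderiv ℝ (fderiv ℝ φ) (z, t) (0, 1)) t :=
    hasDerivAt_comp_time (f := fderiv ℝ φ) hD z t
  simpa using hline.clm_apply (hasDerivAt_const t ((v, 0) : E × ℝ))

/-- The time derivative of a field along a trajectory is its material derivative. -/
theorem hasDerivAt_material {X : E × ℝ → E} (hX : Differentiable ℝ X) {x : ℝ → E} {v : E} {t : ℝ}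
    (hx : HasDerivAt x v t) :
    HasDerivAt (fun τ => X (x τ, τ))
      (deriv (fun τ => X (x t, τ)) t + fderiv ℝ (fun u => X (u, t)) (x t) v) t := by
  have hspace : HasFDerivAt (fun u => X (u, t))
      ((fderiv ℝ X (x t, t)).comp (ContinuousLinearMap.inl ℝ E ℝ)) (x t) :=
    (hX (x t, t)).hasFDerivAt.comp (x t) (hasFDerivAt_prodMk_left (x t) t)
  rw [(hasDerivAt_comp_time hX (x t) t).deriv, hspace.fderiv]
  have hsum : fderiv ℝ X (x t, t) (v, 1) = fderiv ℝ X (x t, t) (0, 1) +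
      ((fderiv ℝ X (x t, t)).comp (ContinuousLinearMap.inl ℝ E ℝ)) v := by
    simp [← map_add]
  rw [← hsum]
  exact HasFDerivAt.comp_hasDerivAt (f := fun τ => (x τ, τ)) t (hX (x t, t)).hasFDerivAt
    (hx.prodMk (hasDerivAt_id t))

/-- The work of a `C¹` field `w` along itself vanishes around a closed curve. -/
theorem integral_inner_deriv_self_eq_zero {w w' : ℝ → E} {a b : ℝ}
    (hw : ∀ s, HasDerivAt w (w' s) s) (hw' : Continuous w') (hab : w a = w b) :
    ∫ s in a..b, ⟪w s, w' s⟫ = 0 := by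
  have hc : Continuous w := continuous_iff_continuousAt.2 fun s => (hw s).continuousAt
  have hd : ∀ s, HasDerivAt (fun s => ⟪w s, w s⟫ / 2) ⟪w s, w' s⟫ s := fun s => by
    have h := ((hw s).inner ℝ (hw s)).div_const 2
    rwa [real_inner_comm (w s) (w' s), add_self_div_two] at h
  rw [intervalIntegral.integral_eq_sub_of_hasDerivAt (fun s _ => hd s)
    ((hc.inner hw').intervalIntegrable a b), hab, sub_self]

end Flow

/-- The transport theorem for circulation integrals: if `φ` is the flow of a `C¹`
field `X` and `γ` is a closed `C¹` curve, then the circulation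
`c(t) = ∫₀¹ ⟨X(φ(γ s, t), t), ∂_s φ(γ s, t)⟩ ds` is differentiable with
`c'(t) = ∫₀¹ ⟨DX/Dt (φ(γ s, t), t), ∂_s φ(γ s, t)⟩ ds`. -/
theorem stmt_3 (X : E2 × ℝ → E2) (φ : E2 × ℝ → E2) (γ : ℝ → E2)
    (hX : ContDiff ℝ 1 X) (hφ : ContDiff ℝ 2 φ)
    (hφ0 : ∀ z, φ (z, 0) = z)
    (hflow : ∀ z t, HasDerivAt (fun τ => φ (z, τ)) (X (φ (z, t), t)) t)
    (hγ : ContDiff ℝ 1 γ) (hclosed : γ 0 = γ 1) (t : ℝ) :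
    HasDerivAt (fun t' => ∫ s in (0:ℝ)..1,
        ⟪X (φ (γ s, t'), t'), deriv (fun u => φ (γ u, t')) s⟫)
      (∫ s in (0:ℝ)..1,
        ⟪deriv (fun τ => X (φ (γ s, t), τ)) t
            + fderiv ℝ (fun u => X (u, t)) (φ (γ s, t)) (X (φ (γ s, t), t)),
          deriv (fun u => φ (γ u, t)) s⟫) t := by
  set G : E2 × ℝ → E2 := fun p => X (φ p, p.2) with hGdef
  have hG : ContDiff ℝ 1 G := hX.comp ((hφ.of_le one_le_two).prodMk contDiff_snd)
  have hXd := hX.differentiable one_ne_zero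
  have hGd := hG.differentiable one_ne_zero
  have hφd := hφ.differentiable two_ne_zero
  have hγd := hγ.differentiable one_ne_zero
  have hγc := hγ.continuous
  have hγ'c : Continuous (deriv γ) := hγ.continuous_deriv le_rfl
  have hGc := hG.continuous
  have hDG : Continuous (fderiv ℝ G) := hG.continuous_fderiv one_ne_zero
  have hDφ : Continuous (fderiv ℝ φ) := hφ.continuous_fderiv two_ne_zero
  have hvel : ∀ s t, deriv (fun u => φ (γ u, t)) s = fderiv ℝ φ (γ s, t) (deriv γ s, 0) :=
    fun s t => (hasDerivAt_comp_curve hφd hγd s t).deriv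
  have hmat : ∀ s, deriv (fun τ => X (φ (γ s, t), τ)) t
      + fderiv ℝ (fun u => X (u, t)) (φ (γ s, t)) (X (φ (γ s, t), t))
      = fderiv ℝ G (γ s, t) (0, 1) := fun s =>
    (hasDerivAt_material hXd (hflow (γ s) t)).unique (hasDerivAt_comp_time hGd (γ s) t)
  simp only [hvel, hmat]
  have hwork : ∫ s in (0:ℝ)..1, ⟪G (γ s, t), fderiv ℝ G (γ s, t) (deriv γ s, 0)⟫ = 0 :=
    integral_inner_deriv_self_eq_zero (fun s => hasDerivAt_comp_curve hGd hγd s t)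
      (by fun_prop) (by rw [hclosed])
  have key := hasDerivAt_intervalIntegral_of_continuous_deriv (a := 0) (b := 1)
    (F := fun t s => ⟪G (γ s, t), fderiv ℝ φ (γ s, t) (deriv γ s, 0)⟫)
    (F' := fun t s => ⟪G (γ s, t), fderiv ℝ G (γ s, t) (deriv γ s, 0)⟫ +
      ⟪fderiv ℝ G (γ s, t) (0, 1), fderiv ℝ φ (γ s, t) (deriv γ s, 0)⟫)
    (fun t => by fun_prop) (by fun_prop)
    (fun t s => (hasDerivAt_comp_time hGd (γ s) t).inner ℝ
      (hasDerivAt_fderiv_flow hφ hflow (γ s) (deriv γ s) t)) t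
  rwa [intervalIntegral.integral_add
    (Continuous.intervalIntegrable (by fun_prop) _ _)
    (Continuous.intervalIntegrable (by fun_prop) _ _), hwork, zero_add] at key
end
end

section
/- Let X : ℝ² × ℝ → ℝ² be twice continuously differentiable and let p : ℝ² × ℝ → ℝ be such that each p(·,t) is twice continuously differentiable. Assume div_z X(z,t) = 0 and ∂_t X(z,t) + D_zX(z,t)(X(z,t)) = −∇_z p(z,t) for all (z,t) (the incompressible Euler equations). Let φ : ℝ² × ℝ → ℝ² satisfy φ(z,0) = z and ∂_t φ(z,t) = X(φ(z,t),t) for all (z,t). Then the vorticity is passively transported: for every z and t, curl_z X(φ(z,t), t) = curl_z X(z, 0). -/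
open MeasureTheory
open scoped ENNReal RealInnerProductSpace

noncomputable section

/-- The curl of a gradient vanishes. -/
theorem curl2_gradient {q : E2 → ℝ} (hq : ContDiff ℝ 2 q) (z : E2) :
    curl2 (gradient q) z = 0 := by
  have hd : DifferentiableAt ℝ (fderiv ℝ q) z :=
    (hq.fderiv_right (m := 1) (by norm_num)).differentiable one_ne_zero z
  have hcoord (i : Fin 2) : HasFDerivAt (fun u => gradient q u i)
      ((fderiv ℝ (fderiv ℝ q) z).flip (EuclideanSpace.single i 1)) z := by
    have h (u : E2) : gradient q u i = fderiv ℝ q u (EuclideanSpace.single i 1) := by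
      rw [gradient, ← InnerProductSpace.toDual_symm_apply (𝕜 := ℝ),
        EuclideanSpace.inner_single_right]
      simp
    simp only [h]
    exact ((ContinuousLinearMap.apply ℝ ℝ
      (EuclideanSpace.single i 1 : E2)).hasFDerivAt).comp z hd.hasFDerivAt
  have hg : DifferentiableAt ℝ (gradient q) z :=
    differentiableAt_euclidean.2 fun i => (hcoord i).differentiableAt
  have hfd (i : Fin 2) (v : E2) : fderiv ℝ (gradient q) z v i
      = fderiv ℝ (fderiv ℝ q) z v (EuclideanSpace.single i 1) :=
    DFunLike.congr_fun
      (((EuclideanSpace.proj i : E2 →L[ℝ] ℝ).hasFDerivAt.comp z hg.hasFDerivAt).unique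
        (hcoord i)) v
  have hsymm : IsSymmSndFDerivAt ℝ q z :=
    hq.contDiffAt.isSymmSndFDerivAt (by simp)
  have h := hsymm.eq (EuclideanSpace.single 0 1) (EuclideanSpace.single 1 1)
  rw [curl2, hfd, hfd, h, sub_self]

/-- The spatial derivative of a time-dependent field is a partial derivative of the field. -/
theorem hasFDerivAt_slice {X : E2 × ℝ → E2} (hX : Differentiable ℝ X) (z : E2) (t : ℝ) :
    HasFDerivAt (fun w => X (w, t))
      ((fderiv ℝ X (z, t)).comp (ContinuousLinearMap.inl ℝ E2 ℝ)) z :=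
  (hX (z, t)).hasFDerivAt.comp z (hasFDerivAt_prodMk_left z t)

/-- For a trace-free linear map of the plane, the square is a multiple of the identity, hence has
symmetric matrix. -/
theorem sq_apply_symm_of_trace_eq_zero (A : E2 →L[ℝ] E2)
    (hA : A (EuclideanSpace.single 0 1) 0 + A (EuclideanSpace.single 1 1) 1 = 0) :
    A (A (EuclideanSpace.single 0 1)) 1 = A (A (EuclideanSpace.single 1 1)) 0 := by
  have hexp (v : E2) :
      A v = v 0 • A (EuclideanSpace.single 0 1) + v 1 • A (EuclideanSpace.single 1 1) := by
    rw [← map_smul, ← map_smul, ← map_add]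
    congr 1
    ext i
    fin_cases i <;> simp
  rw [hexp (A (EuclideanSpace.single 0 1)), hexp (A (EuclideanSpace.single 1 1))]
  simp only [PiLp.add_apply, PiLp.smul_apply, smul_eq_mul]
  linear_combination
    (A (EuclideanSpace.single 0 1) 1 - A (EuclideanSpace.single 1 1) 0) * hA

/-- The material derivative of the vorticity of an incompressible Euler flow vanishes. -/
theorem material_deriv_vorticity_eq_zero {X : E2 × ℝ → E2} {q : E2 → ℝ} {z : E2} {t : ℝ}
    (hX : ContDiff ℝ 2 X) (hq : ContDiff ℝ 2 q)
    (hdiv : div2 (fun w => X (w, t)) z = 0)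
    (heuler : ∀ u, deriv (fun τ => X (u, τ)) t
        + fderiv ℝ (fun w => X (w, t)) u (X (u, t)) = -gradient q u) :
    fderiv ℝ (fderiv ℝ X) (z, t) (X (z, t), 1) (EuclideanSpace.single 0 1, 0) 1
      - fderiv ℝ (fderiv ℝ X) (z, t) (X (z, t), 1) (EuclideanSpace.single 1 1, 0) 0 = 0 := by
  have hXd : Differentiable ℝ X := hX.differentiable two_ne_zero
  have hDd : Differentiable ℝ (fderiv ℝ X) :=
    (hX.fderiv_right (m := 1) (by norm_num)).differentiable one_ne_zero
  have hgrad : gradient q = fun u => -fderiv ℝ X (u, t) (X (u, t), 1) := by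
    funext u
    have hτ : HasDerivAt (fun τ => X (u, τ)) (fderiv ℝ X (u, t) (0, 1)) t :=
      (hXd (u, t)).hasFDerivAt.comp_hasDerivAt t
        ((hasDerivAt_const t u).prodMk (hasDerivAt_id t))
    have h := heuler u
    rw [hτ.deriv, (hasFDerivAt_slice hXd u t).fderiv, ContinuousLinearMap.comp_apply,
      ContinuousLinearMap.inl_apply, ← map_add, Prod.mk_add_mk, zero_add, add_zero] at h
    rw [h, neg_neg]
  have hD : HasFDerivAt (fun u => fderiv ℝ X (u, t))
      ((fderiv ℝ (fderiv ℝ X) (z, t)).comp (ContinuousLinearMap.inl ℝ E2 ℝ)) z :=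
    (hDd (z, t)).hasFDerivAt.comp z (hasFDerivAt_prodMk_left z t)
  have hF := (hD.clm_apply
    ((hasFDerivAt_slice hXd z t).prodMk (hasFDerivAt_const (1 : ℝ) z))).fun_neg
  have hcurl := curl2_gradient hq z
  rw [hgrad, curl2, hF.fderiv] at hcurl
  have hsymm : IsSymmSndFDerivAt ℝ X (z, t) := hX.contDiffAt.isSymmSndFDerivAt (by simp)
  rw [div2, (hasFDerivAt_slice hXd z t).fderiv] at hdiv
  have hsq := sq_apply_symm_of_trace_eq_zero _ hdiv
  rw [hsymm.eq (X (z, t), 1), hsymm.eq (X (z, t), 1)]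
  simp at hcurl hsq
  linarith

/-- Helmholtz: for a solution of the incompressible Euler equations on the plane,
the vorticity is passively transported by the flow:
`curl_z X(φ(z,t), t) = curl_z X(z, 0)`. -/
theorem stmt_4 (X : E2 × ℝ → E2) (p : E2 × ℝ → ℝ) (φ : E2 × ℝ → E2)
    (hX : ContDiff ℝ 2 X)
    (hp : ∀ t, ContDiff ℝ 2 (fun z => p (z, t)))
    (hdiv : ∀ z t, div2 (fun w => X (w, t)) z = 0)
    (heuler : ∀ z t, deriv (fun τ => X (z, τ)) t
        + fderiv ℝ (fun u => X (u, t)) z (X (z, t))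
      = -gradient (fun u => p (u, t)) z)
    (hφ0 : ∀ z, φ (z, 0) = z)
    (hflow : ∀ z t, HasDerivAt (fun τ => φ (z, τ)) (X (φ (z, t), t)) t) :
    ∀ z t, curl2 (fun w => X (w, t)) (φ (z, t)) = curl2 (fun w => X (w, 0)) z := by
  intro z t
  have hXd : Differentiable ℝ X := hX.differentiable two_ne_zero
  have hDd : Differentiable ℝ (fderiv ℝ X) :=
    (hX.fderiv_right (m := 1) (by norm_num)).differentiable one_ne_zero
  have hcomp (s : ℝ) (v : E2 × ℝ) (i : Fin 2) :
      HasDerivAt (fun τ => fderiv ℝ X (φ (z, τ), τ) v i)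
        (fderiv ℝ (fderiv ℝ X) (φ (z, s), s) (X (φ (z, s), s), 1) v i) s := by
    have h := HasFDerivAt.comp_hasDerivAt (f := fun τ => (φ (z, τ), τ)) s
      (hDd (φ (z, s), s)).hasFDerivAt ((hflow z s).prodMk (hasDerivAt_id s))
    exact ((EuclideanSpace.proj i : E2 →L[ℝ] ℝ).comp
      (ContinuousLinearMap.apply ℝ E2 v)).hasFDerivAt.comp_hasDerivAt s h
  have hω (s : ℝ) :
      HasDerivAt (fun τ => curl2 (fun w => X (w, τ)) (φ (z, τ))) 0 s := by
    have h := (hcomp s (EuclideanSpace.single 0 1, 0) 1).fun_sub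
      (hcomp s (EuclideanSpace.single 1 1, 0) 0)
    rw [material_deriv_vorticity_eq_zero hX (hp s) (hdiv _ s) (fun u => heuler u s)] at h
    simp only [curl2, (hasFDerivAt_slice hXd _ _).fderiv]
    exact h
  have h := is_const_of_deriv_eq_zero (fun s => (hω s).differentiableAt)
    (fun s => (hω s).deriv) t 0
  simpa only [hφ0] using h
end
end

section
/- Let X : ℝ² × ℝ → ℝ² be continuously differentiable and let p : ℝ² × ℝ → ℝ be such that each p(·,t) is continuously differentiable, with ∂_t X(z,t) + D_zX(z,t)(X(z,t)) = −∇_z p(z,t) for all (z,t). Let φ : ℝ² × ℝ → ℝ² be twice continuously differentiable with φ(z,0) = z and ∂_t φ(z,t) = X(φ(z,t),t) for all (z,t), and let γ : [0,1] → ℝ² be a C¹ curve with γ(0) = γ(1). Then the circulation is conserved: the function c(t) := ∫₀¹ ⟨X(φ(γ(s),t), t), ∂_s[φ(γ(s),t)]⟩ ds satisfies c(t) = c(0) for all t. -/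
open MeasureTheory
open scoped ENNReal RealInnerProductSpace

noncomputable section

/-- Differentiation under an interval integral whose integrand has a jointly continuous partial
derivative in the parameter. -/
lemma hasDerivAt_intervalIntegral_of_continuous {E : Type*} [NormedAddCommGroup E]
    [NormedSpace ℝ E] {F F' : ℝ → ℝ → E} (a b t : ℝ)
    (hF : ∀ τ, Continuous (F τ)) (hF' : Continuous (Function.uncurry F'))
    (hderiv : ∀ τ s, HasDerivAt (fun x => F x s) (F' τ s) τ) :
    HasDerivAt (fun τ => ∫ s in a..b, F τ s) (∫ s in a..b, F' t s) t := by
  obtain ⟨C, hC⟩ := ((isCompact_Icc (a := t - 1) (b := t + 1)).prod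
    (isCompact_uIcc (a := a) (b := b))).exists_bound_of_continuousOn hF'.continuousOn
  refine (intervalIntegral.hasDerivAt_integral_of_dominated_loc_of_deriv_le
    (F := F) (F' := F') (bound := fun _ => C)
    (Icc_mem_nhds (sub_one_lt t) (lt_add_one t))
    (.of_forall fun τ => (hF τ).aestronglyMeasurable) ((hF t).intervalIntegrable a b)
    (hF'.comp (Continuous.prodMk_right t)).aestronglyMeasurable
    (.of_forall fun s hs τ hτ => hC (τ, s) ⟨hτ, Set.uIoc_subset_uIcc hs⟩)
    intervalIntegrable_const (.of_forall fun s _ τ _ => hderiv τ s)).2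

/-- If `∂ₜφ = V` for a `C²` map `φ`, then the time derivative of `D_zφ(v)` is `D_zV(v)`. -/
lemma hasDerivAt_fderiv_of_partial_eq {E F : Type*} [NormedAddCommGroup E] [NormedSpace ℝ E]
    [NormedAddCommGroup F] [NormedSpace ℝ F] {φ V : E × ℝ → F} (hφ : ContDiff ℝ 2 φ)
    (hV : ∀ q, fderiv ℝ φ q (0, 1) = V q) (z v : E) (t : ℝ) :
    HasDerivAt (fun τ => fderiv ℝ φ (z, τ) (v, 0)) (fderiv ℝ V (z, t) (v, 0)) t := by
  have hd : DifferentiableAt ℝ (fderiv ℝ φ) (z, t) :=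
    ((hφ.fderiv_right (m := 1) (by norm_num)).differentiable one_ne_zero) (z, t)
  have hfV : fderiv ℝ V (z, t) (v, 0) = fderiv ℝ (fderiv ℝ φ) (z, t) (v, 0) (0, 1) := by
    rw [← funext hV, fderiv_clm_apply hd (differentiableAt_const _)]
    simp
  rw [hfV, (hφ.contDiffAt.isSymmSndFDerivAt (by simp)).eq]
  have hline := hd.hasFDerivAt.comp_hasDerivAt t
    ((hasDerivAt_const t z).prodMk (hasDerivAt_id t))
  simpa using hline.clm_apply (hasDerivAt_const t ((v, 0) : E × ℝ))

/-- Kelvin's circulation theorem: if `X` satisfies the Euler momentum equation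
`∂_t X + D_zX(X) = −∇_z p` and `φ` is its flow, then the circulation of `X`
around the image of a closed `C¹` curve is conserved. -/
theorem stmt_5 (X : E2 × ℝ → E2) (p : E2 × ℝ → ℝ) (φ : E2 × ℝ → E2) (γ : ℝ → E2)
    (hX : ContDiff ℝ 1 X)
    (hp : ∀ t, ContDiff ℝ 1 (fun z => p (z, t)))
    (heuler : ∀ z t, deriv (fun τ => X (z, τ)) t
        + fderiv ℝ (fun u => X (u, t)) z (X (z, t))
      = -gradient (fun u => p (u, t)) z)
    (hφ : ContDiff ℝ 2 φ)
    (hφ0 : ∀ z, φ (z, 0) = z)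
    (hflow : ∀ z t, HasDerivAt (fun τ => φ (z, τ)) (X (φ (z, t), t)) t)
    (hγ : ContDiff ℝ 1 γ) (hclosed : γ 0 = γ 1) :
    ∀ t, (∫ s in (0:ℝ)..1, ⟪X (φ (γ s, t), t), deriv (fun u => φ (γ u, t)) s⟫)
      = ∫ s in (0:ℝ)..1, ⟪X (φ (γ s, 0), 0), deriv (fun u => φ (γ u, 0)) s⟫ := by
  have hXd : Differentiable ℝ X := hX.differentiable one_ne_zero
  have hφd : Differentiable ℝ φ := hφ.differentiable two_ne_zero
  have hγd : Differentiable ℝ γ := hγ.differentiable one_ne_zero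
  let V : E2 × ℝ → E2 := fun q => X (φ q, q.2)
  have hVC : ContDiff ℝ 1 V := hX.comp ((hφ.of_le one_le_two).prodMk contDiff_snd)
  have hVd : Differentiable ℝ V := hVC.differentiable one_ne_zero
  have hγ' : Continuous (deriv γ) := hγ.continuous_deriv le_rfl
  have hγc : Continuous γ := hγ.continuous
  have hφ' : Continuous (fderiv ℝ φ) := hφ.continuous_fderiv two_ne_zero
  have hVC' : Continuous (fderiv ℝ V) := hVC.continuous_fderiv one_ne_zero
  have hVc : Continuous V := hVC.continuous
  have htime (z : E2) (t : ℝ) : HasDerivAt (fun τ : ℝ => (z, τ)) ((0 : E2), (1 : ℝ)) t :=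
    (hasDerivAt_const t z).prodMk (hasDerivAt_id t)
  have hcurve (s t : ℝ) : HasDerivAt (fun u => (γ u, t)) (deriv γ s, (0 : ℝ)) s :=
    (hγd s).hasDerivAt.prodMk (hasDerivAt_const s t)
  have hφV (q : E2 × ℝ) : fderiv ℝ φ q (0, 1) = V q :=
    ((hφd q).hasFDerivAt.comp_hasDerivAt q.2 (htime q.1 q.2)).unique (hflow q.1 q.2)
  have hφs (s t : ℝ) :
      HasDerivAt (fun u => φ (γ u, t)) (fderiv ℝ φ (γ s, t) (deriv γ s, 0)) s :=
    (hφd _).hasFDerivAt.comp_hasDerivAt s (hcurve s t)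
  have hVs (s t : ℝ) :
      HasDerivAt (fun u => V (γ u, t)) (fderiv ℝ V (γ s, t) (deriv γ s, 0)) s :=
    (hVd _).hasFDerivAt.comp_hasDerivAt s (hcurve s t)
  have hVt (z : E2) (t : ℝ) :
      HasDerivAt (fun τ => V (z, τ)) (fderiv ℝ V (z, t) (0, 1)) t :=
    (hVd _).hasFDerivAt.comp_hasDerivAt t (htime z t)
  have heulerV (z : E2) (t : ℝ) :
      fderiv ℝ V (z, t) (0, 1) = -gradient (fun u => p (u, t)) (φ (z, t)) := by
    have hXq := (hXd (φ (z, t), t)).hasFDerivAt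
    have hV' : HasDerivAt (fun τ => V (z, τ))
        (fderiv ℝ X (φ (z, t), t) (X (φ (z, t), t), 1)) t :=
      HasFDerivAt.comp_hasDerivAt (f := fun τ => (φ (z, τ), τ)) t hXq
        ((hflow z t).prodMk (hasDerivAt_id t))
    have hspace : fderiv ℝ (fun u => X (u, t)) (φ (z, t)) (X (φ (z, t), t))
        = fderiv ℝ X (φ (z, t), t) (X (φ (z, t), t), 0) := by
      have hcomp : HasFDerivAt (fun u => X (u, t)) _ (φ (z, t)) :=
        HasFDerivAt.comp (f := fun u => (u, t)) (φ (z, t)) hXq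
          (hasFDerivAt_prodMk_left (φ (z, t)) t)
      rw [hcomp.fderiv]
      simp
    have hXt : HasDerivAt (fun τ => X (φ (z, t), τ)) (fderiv ℝ X (φ (z, t), t) (0, 1)) t :=
      hXq.comp_hasDerivAt t (htime _ t)
    rw [← heuler, hspace, hXt.deriv, ← map_add,
      (hVt z t).unique hV']
    simp
  have hderiv (t : ℝ) : HasDerivAt
      (fun τ => ∫ s in (0:ℝ)..1, ⟪V (γ s, τ), fderiv ℝ φ (γ s, τ) (deriv γ s, 0)⟫)
      (∫ s in (0:ℝ)..1, (⟪V (γ s, t), fderiv ℝ V (γ s, t) (deriv γ s, 0)⟫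
        + ⟪fderiv ℝ V (γ s, t) (0, 1), fderiv ℝ φ (γ s, t) (deriv γ s, 0)⟫)) t := by
    refine hasDerivAt_intervalIntegral_of_continuous
      (F := fun τ s => ⟪V (γ s, τ), fderiv ℝ φ (γ s, τ) (deriv γ s, 0)⟫)
      (F' := fun τ s => ⟪V (γ s, τ), fderiv ℝ V (γ s, τ) (deriv γ s, 0)⟫
        + ⟪fderiv ℝ V (γ s, τ) (0, 1), fderiv ℝ φ (γ s, τ) (deriv γ s, 0)⟫) 0 1 t ?_ ?_ ?_
    · intro τ
      fun_prop
    · simp only [Function.uncurry_def]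
      fun_prop
    · intro τ s
      exact (hVt (γ s) τ).inner ℝ (hasDerivAt_fderiv_of_partial_eq hφ hφV (γ s) (deriv γ s) τ)
  have hexact (t : ℝ) :
      ∫ s in (0:ℝ)..1, (⟪V (γ s, t), fderiv ℝ V (γ s, t) (deriv γ s, 0)⟫
        + ⟪fderiv ℝ V (γ s, t) (0, 1), fderiv ℝ φ (γ s, t) (deriv γ s, 0)⟫) = 0 := by
    have hprim (s : ℝ) : HasDerivAt
        (fun u => ‖V (γ u, t)‖ ^ 2 / 2 - p (φ (γ u, t), t))
        (⟪V (γ s, t), fderiv ℝ V (γ s, t) (deriv γ s, 0)⟫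
          + ⟪fderiv ℝ V (γ s, t) (0, 1), fderiv ℝ φ (γ s, t) (deriv γ s, 0)⟫) s := by
      have hps := (((hp t).differentiable one_ne_zero (φ (γ s, t))).hasGradientAt
        |>.hasFDerivAt).comp_hasDerivAt s (hφs s t)
      rw [heulerV, inner_neg_left, ← sub_eq_add_neg]
      refine (((hVs s t).norm_sq.div_const 2).sub hps).congr_deriv ?_
      simp
    rw [intervalIntegral.integral_eq_sub_of_hasDerivAt (fun s _ => hprim s)
      (Continuous.intervalIntegrable (by fun_prop) 0 1), hclosed, sub_self]
  intro t
  simp only [fun s t => (hφs s t).deriv]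
  exact is_const_of_deriv_eq_zero (fun τ => (hderiv τ).differentiableAt)
    (fun τ => (hderiv τ).deriv.trans (hexact τ)) t 0
end
end

section
/- Let X : ℝ² × ℝ → ℝ² be twice continuously differentiable with div_z X(z,t) = 0 for all (z,t), and suppose the vorticity ω(z,t) := curl_z X(z,t) satisfies the transport equation ∂_t ω(z,t) + ⟨∇_z ω(z,t), X(z,t)⟩ = 0 for all (z,t). Then there exists a pressure: a function p : ℝ² × ℝ → ℝ such that each p(·,t) is differentiable and ∂_t X(z,t) + D_zX(z,t)(X(z,t)) = −∇_z p(z,t) for all (z,t). -/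
open MeasureTheory
open scoped ENNReal RealInnerProductSpace

noncomputable section

/-- Expansion of a planar vector in the standard basis. -/
lemma eq_smul_single_add_smul_single (v : E2) :
    v = v 0 • EuclideanSpace.single (0 : Fin 2) (1 : ℝ)
      + v 1 • EuclideanSpace.single (1 : Fin 2) (1 : ℝ) := by
  ext i
  fin_cases i <;> simp

/-- A differentiable curl-free field on the plane is a gradient. -/
lemma exists_hasGradientAt_of_curl2_eq_zero {Y : E2 → E2} (hY : Differentiable ℝ Y)
    (hcurl : ∀ z, curl2 Y z = 0) : ∃ f : E2 → ℝ, ∀ z, HasGradientAt f (Y z) z := by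
  have hform (z : E2) : HasFDerivAt (fun w => innerSL ℝ (Y w)) ((innerSL ℝ).comp (fderiv ℝ Y z)) z :=
    (innerSL ℝ).hasFDerivAt.comp z (hY z).hasFDerivAt
  obtain ⟨f, hf⟩ := convex_univ.exists_forall_hasFDerivAt_of_fderiv_symmetric isOpen_univ
    (fun z _ => (hform z).differentiableAt.differentiableWithinAt) (fun z _ x y => by
      have hc := hcurl z
      rw [curl2] at hc
      rw [(hform z).fderiv]
      change ⟪fderiv ℝ Y z x, y⟫ = ⟪fderiv ℝ Y z y, x⟫
      have expand (v : E2) : fderiv ℝ Y z v = v 0 • fderiv ℝ Y z (EuclideanSpace.single 0 1)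
          + v 1 • fderiv ℝ Y z (EuclideanSpace.single 1 1) := by
        conv_lhs => rw [eq_smul_single_add_smul_single v, map_add, map_smul, map_smul]
      rw [expand x, expand y]
      simp only [PiLp.inner_apply, Fin.sum_univ_two, PiLp.add_apply, PiLp.smul_apply, smul_eq_mul,
        RCLike.inner_apply, conj_trivial]
      linear_combination (x 0 * y 1 - x 1 * y 0) * hc)
  exact ⟨f, fun z => hf z trivial⟩

section SpaceTime

variable {E F : Type*} [NormedAddCommGroup E] [NormedSpace ℝ E] [NormedAddCommGroup F]
  [NormedSpace ℝ F] {f : E × ℝ → F} {z : E} {t : ℝ}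

lemma DifferentiableAt.hasFDerivAt_space_slice (hf : DifferentiableAt ℝ f (z, t)) :
    HasFDerivAt (fun w => f (w, t)) ((fderiv ℝ f (z, t)).comp (.inl ℝ E ℝ)) z :=
  hf.hasFDerivAt.comp z (hasFDerivAt_prodMk_left z t)

lemma DifferentiableAt.hasDerivAt_time_slice (hf : DifferentiableAt ℝ f (z, t)) :
    HasDerivAt (fun τ => f (z, τ)) (fderiv ℝ f (z, t) (0, 1)) t := by
  have h := (hf.hasFDerivAt.comp t (hasFDerivAt_prodMk_right z t)).hasDerivAt
  simpa using! h

/-- The material derivative along `v` is the space-time derivative in direction `(v, 1)`. -/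
lemma DifferentiableAt.deriv_add_fderiv_slice (hf : DifferentiableAt ℝ f (z, t)) (v : E) :
    deriv (fun τ => f (z, τ)) t + fderiv ℝ (fun w => f (w, t)) z v = fderiv ℝ f (z, t) (v, 1) := by
  rw [hf.hasDerivAt_time_slice.deriv, hf.hasFDerivAt_space_slice.fderiv,
    ContinuousLinearMap.comp_apply, ContinuousLinearMap.inl_apply, ← map_add]
  simp

end SpaceTime

/-- The vorticity of a time-dependent planar field in terms of its space-time derivative. -/
lemma vorticity_eq {X : E2 × ℝ → E2} (hX : Differentiable ℝ X) :
    (fun q : E2 × ℝ => curl2 (fun w => X (w, q.2)) q.1) = fun q =>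
      fderiv ℝ X q (EuclideanSpace.single 0 1, 0) 1
        - fderiv ℝ X q (EuclideanSpace.single 1 1, 0) 0 := by
  funext q
  rw [curl2, (hX (q.1, q.2)).hasFDerivAt_space_slice.fderiv]
  rfl

/-- The spatial curl of the acceleration of a divergence-free planar field is the material
derivative of its vorticity. -/
lemma curl2_material_acceleration {X : E2 × ℝ → E2} (hX : ContDiff ℝ 2 X) {z : E2} {t : ℝ}
    (hdiv : div2 (fun w => X (w, t)) z = 0) :
    curl2 (fun w => fderiv ℝ X (w, t) (X (w, t), 1)) z
      = fderiv ℝ (fun q : E2 × ℝ => curl2 (fun w => X (w, q.2)) q.1) (z, t) (X (z, t), 1) := by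
  have hX1 : Differentiable ℝ X := hX.differentiable (by norm_num)
  have hA : Differentiable ℝ (fderiv ℝ X) :=
    (hX.fderiv_right (m := 1) (by norm_num)).differentiable (by norm_num)
  have hsymm (u v : E2 × ℝ) : fderiv ℝ (fderiv ℝ X) (z, t) u v = fderiv ℝ (fderiv ℝ X) (z, t) v u :=
    hX.contDiffAt.isSymmSndFDerivAt (by simp) u v
  have hentry (u : E2 × ℝ) (i : Fin 2) : HasFDerivAt (fun q => fderiv ℝ X q u i)
      ((EuclideanSpace.proj i).comp ((fderiv ℝ (fderiv ℝ X) (z, t)).flip u)) (z, t) := by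
    have h := (hA (z, t)).hasFDerivAt.clm_apply (hasFDerivAt_const u (z, t))
    have h' := (EuclideanSpace.proj i : E2 →L[ℝ] ℝ).hasFDerivAt.comp (z, t) h
    convert! h' using 1
    ext <;> simp
  have hacc : HasFDerivAt (fun q => fderiv ℝ X q (X q, 1))
      ((fderiv ℝ X (z, t)).comp ((fderiv ℝ X (z, t)).prod 0)
        + (fderiv ℝ (fderiv ℝ X) (z, t)).flip (X (z, t), 1)) (z, t) :=
    (hA (z, t)).hasFDerivAt.clm_apply ((hX1 (z, t)).hasFDerivAt.prodMk (hasFDerivAt_const 1 (z, t)))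
  have hslice := hacc.differentiableAt.hasFDerivAt_space_slice
  rw [hacc.fderiv] at hslice
  rw [vorticity_eq hX1, ((hentry _ 1).fun_sub (hentry _ 0)).fderiv, curl2, hslice.fderiv]
  rw [div2, (hX1 (z, t)).hasFDerivAt_space_slice.fderiv] at hdiv
  have expand (v : E2) : fderiv ℝ X (z, t) (v, 0)
      = v 0 • fderiv ℝ X (z, t) (EuclideanSpace.single 0 1, 0)
        + v 1 • fderiv ℝ X (z, t) (EuclideanSpace.single 1 1, 0) := by
    rw [← map_smul, ← map_smul, ← map_add]
    congr 1
    ext1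
    · simpa using eq_smul_single_add_smul_single v
    · simp
  simp only [ContinuousLinearMap.comp_apply, ContinuousLinearMap.inl_apply,
    add_apply, sub_apply, ContinuousLinearMap.flip_apply,
    ContinuousLinearMap.prod_apply, zero_apply, PiLp.proj_apply,
    PiLp.add_apply] at hdiv ⊢
  rw [expand (fderiv ℝ X (z, t) (EuclideanSpace.single 0 1, 0)),
    expand (fderiv ℝ X (z, t) (EuclideanSpace.single 1 1, 0)),
    hsymm (EuclideanSpace.single 0 1, 0), hsymm (EuclideanSpace.single 1 1, 0)]
  simp only [PiLp.add_apply, PiLp.smul_apply, smul_eq_mul]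
  linear_combination (fderiv ℝ X (z, t) (EuclideanSpace.single 0 1, 0) 1
    - fderiv ℝ X (z, t) (EuclideanSpace.single 1 1, 0) 0) * hdiv

/-- Converse half of the Helmholtz–Kelvin theorem on the plane: if a `C²`
divergence-free field has vorticity satisfying the transport equation
`∂_t ω + ⟨∇_z ω, X⟩ = 0`, then there is a pressure `p` with
`∂_t X + D_zX(X) = −∇_z p`. -/
theorem stmt_6 (X : E2 × ℝ → E2) (hX : ContDiff ℝ 2 X)
    (hdiv : ∀ z t, div2 (fun w => X (w, t)) z = 0)
    (htransport : ∀ z t, deriv (fun τ => curl2 (fun w => X (w, τ)) z) t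
        + ⟪gradient (fun w => curl2 (fun u => X (u, t)) w) z, X (z, t)⟫ = 0) :
    ∃ p : E2 × ℝ → ℝ, (∀ t, Differentiable ℝ (fun z => p (z, t))) ∧
      ∀ z t, deriv (fun τ => X (z, τ)) t
          + fderiv ℝ (fun u => X (u, t)) z (X (z, t))
        = -gradient (fun u => p (u, t)) z := by
  have hX1 : Differentiable ℝ X := hX.differentiable (by norm_num)
  have hA : Differentiable ℝ (fderiv ℝ X) :=
    (hX.fderiv_right (m := 1) (by norm_num)).differentiable (by norm_num)
  have hvort : Differentiable ℝ (fun q : E2 × ℝ => curl2 (fun w => X (w, q.2)) q.1) := by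
    rw [vorticity_eq hX1]
    fun_prop
  have hcurl0 (t : ℝ) (z : E2) : curl2 (fun w => fderiv ℝ X (w, t) (X (w, t), 1)) z = 0 := by
    rw [curl2_material_acceleration hX (hdiv z t), ← (hvort (z, t)).deriv_add_fderiv_slice,
      ← htransport z t, gradient, InnerProductSpace.toDual_symm_apply]
  have hacc (t : ℝ) : Differentiable ℝ (fun w => fderiv ℝ X (w, t) (X (w, t), 1)) := by
    fun_prop
  choose f hf using fun t => exists_hasGradientAt_of_curl2_eq_zero (hacc t) (hcurl0 t)
  refine ⟨fun q => -f q.2 q.1, fun t z => (hf t z).differentiableAt.neg, fun z t => ?_⟩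
  rw [(hX1 (z, t)).deriv_add_fderiv_slice, ← (hf t z).gradient]
  simp only [gradient, fderiv_fun_neg, map_neg, neg_neg]
end
end

section
/- Let ω : ℝ² → ℝ be continuously differentiable, let a < b be real numbers, and suppose K := ω⁻¹([a,b]) is compact. Then (b − a) · inf_{r ∈ (a,b)} H¹(ω⁻¹({r})) ≤ (sup_{z ∈ K} ‖∇ω(z)‖) · vol(K), where H¹ denotes the one-dimensional Hausdorff measure on ℝ² and vol denotes two-dimensional Lebesgue measure. -/
open MeasureTheory
open scoped ENNReal RealInnerProductSpace

noncomputable section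

open Set Filter Topology
open scoped NNReal

/-- The upper integral over `r` of the length of `s ∩ f ⁻¹' {r}` is at most `C`. -/
def LevelLengthBound (f : E2 → ℝ) (s : Set E2) (C : ℝ≥0∞) : Prop :=
  ∃ g : ℝ → ℝ≥0∞, Measurable g ∧ (∀ r, μH[1] (s ∩ f ⁻¹' {r}) ≤ g r) ∧ ∫⁻ r, g r ≤ C

namespace LevelLengthBound

variable {f : E2 → ℝ} {s t : Set E2} {C D : ℝ≥0∞}

theorem mono (h : LevelLengthBound f s C) (hts : t ⊆ s) (hCD : C ≤ D) :
    LevelLengthBound f t D := by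
  obtain ⟨g, hg, hle, hint⟩ := h
  exact ⟨g, hg, fun r => (measure_mono (inter_subset_inter_left _ hts)).trans (hle r),
    hint.trans hCD⟩

theorem union (hs : LevelLengthBound f s C) (ht : LevelLengthBound f t D) :
    LevelLengthBound f (s ∪ t) (C + D) := by
  obtain ⟨g, hg, hgle, hgint⟩ := hs
  obtain ⟨h, hh, hhle, hhint⟩ := ht
  refine ⟨fun r => g r + h r, hg.add hh, fun r => ?_, ?_⟩
  · rw [union_inter_distrib_right]
    exact (measure_union_le _ _).trans (add_le_add (hgle r) (hhle r))
  · rw [lintegral_add_left hg]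
    exact add_le_add hgint hhint

theorem iUnion {ι : Type*} [Countable ι] {s : ι → Set E2} {C : ι → ℝ≥0∞}
    (h : ∀ i, LevelLengthBound f (s i) (C i)) :
    LevelLengthBound f (⋃ i, s i) (∑' i, C i) := by
  choose g hg hle hint using h
  refine ⟨fun r => ∑' i, g i r, Measurable.tsum hg, fun r => ?_, ?_⟩
  · rw [iUnion_inter]
    exact (measure_iUnion_le _).trans (ENNReal.tsum_le_tsum fun i => hle i r)
  · rw [lintegral_tsum fun i => (hg i).aemeasurable]
    exact ENNReal.tsum_le_tsum hint

end LevelLengthBound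

theorem isometry_vertical_line (x : ℝ) :
    Isometry fun y : ℝ => (WithLp.toLp 2 ![x, y] : E2) := by
  refine Isometry.of_dist_eq fun y y' => ?_
  simp [EuclideanSpace.dist_eq, Real.sqrt_sq_eq_abs, Real.dist_eq]

/-- Fubini's theorem in the plane, with vertical slices measured by `μH[1]`. -/
theorem measurable_hausdorffMeasure_slice {B : Set E2} (hB : MeasurableSet B) :
    Measurable (fun x : ℝ => μH[1] (B ∩ {z | z 0 = x})) ∧
      ∫⁻ x : ℝ, μH[1] (B ∩ {z | z 0 = x}) = volume B := by
  let e : E2 ≃ᵐ ℝ × ℝ :=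
    (MeasurableEquiv.toLp 2 (Fin 2 → ℝ)).symm.trans MeasurableEquiv.finTwoArrow
  have he : MeasurePreserving e.symm := by
    refine MeasurePreserving.symm e ?_
    exact (volume_preserving_finTwoArrow ℝ).comp (PiLp.volume_preserving_ofLp (Fin 2))
  have hslice (x : ℝ) : μH[1] (B ∩ {z | z 0 = x}) = volume (Prod.mk x ⁻¹' (e.symm ⁻¹' B)) := by
    rw [← hausdorffMeasure_real,
      ← (isometry_vertical_line x).hausdorffMeasure_image (Or.inl zero_le_one)]
    congr 1
    ext z
    constructor
    · rintro ⟨hz, rfl⟩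
      have hz' : (WithLp.toLp 2 ![z 0, z 1] : E2) = z := by
        ext i; fin_cases i <;> rfl
      exact ⟨z 1, by change (WithLp.toLp 2 ![z 0, z 1] : E2) ∈ B; rwa [hz'], hz'⟩
    · rintro ⟨y, hy, rfl⟩
      exact ⟨hy, rfl⟩
  have hm : MeasurableSet (e.symm ⁻¹' B) := e.symm.measurable hB
  simp_rw [hslice]
  refine ⟨measurable_measure_prodMk_left hm, ?_⟩
  rw [← Measure.prod_apply hm, ← Measure.volume_eq_prod, he.measure_preimage hB.nullMeasurableSet]

theorem LipschitzOnWith.volume_image_le {K : ℝ≥0} {f : E2 → E2} {s : Set E2}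
    (h : LipschitzOnWith K f s) : volume (f '' s) ≤ (K : ℝ≥0∞) ^ 2 * volume s := by
  have h2 : (Module.finrank ℝ E2 : ℝ) = 2 := by simp
  have : (μH[2] : Measure E2).IsAddHaarMeasure := by
    rw [← h2]; infer_instance
  rw [Measure.isAddLeftInvariant_eq_smul (volume : Measure E2) μH[2]]
  have := h.hausdorffMeasure_image_le (d := 2) zero_le_two
  simp only [Measure.smul_apply, ENNReal.rpow_ofNat] at this ⊢
  rw [mul_smul_comm]
  gcongr

theorem lintegral_comp_div {g : ℝ → ℝ≥0∞} (hg : Measurable g) {L : ℝ} (hL : 0 < L) :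
    ∫⁻ r, g (r / L) = ENNReal.ofReal L * ∫⁻ x, g x := by
  conv_lhs => rw [← Real.smul_map_volume_mul_left hL.ne']
  rw [lintegral_smul_measure, lintegral_map (by fun_prop) (by fun_prop), abs_of_pos hL]
  simp [mul_div_cancel_left₀ _ hL.ne']

/-- Straightening a function near a noncritical point by a map that distorts distances by at most
the factor `κ`. -/
theorem exists_straightening {f : E2 → ℝ} {z₀ : E2} (hf : HasStrictFDerivAt f (fderiv ℝ f z₀) z₀)
    (h0 : fderiv ℝ f z₀ ≠ 0) {κ : ℝ≥0} (hκ : 1 < κ) :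
    ∃ U ∈ 𝓝 z₀, ∃ Φ : E2 → E2, (∀ z, Φ z 0 = f z / ‖fderiv ℝ f z₀‖) ∧
      LipschitzOnWith κ Φ U ∧ ∀ x ∈ U, ∀ y ∈ U, dist x y ≤ κ * dist (Φ x) (Φ y) := by
  set L := ‖fderiv ℝ f z₀‖ with hLdef
  have hL : 0 < L := norm_pos_iff.2 h0
  obtain ⟨v, hv⟩ : ∃ v : E2, fderiv ℝ f z₀ = InnerProductSpace.toDual ℝ E2 v :=
    ⟨_, (LinearIsometryEquiv.apply_symm_apply _ _).symm⟩
  have hvw (w : E2) : fderiv ℝ f z₀ w = v 0 * w 0 + v 1 * w 1 := by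
    rw [hv, InnerProductSpace.toDual_apply_apply]
    simp [PiLp.inner_apply, Fin.sum_univ_two, mul_comm]
  have hvL : v 0 ^ 2 + v 1 ^ 2 = L ^ 2 := by
    rw [hLdef, hv, LinearIsometryEquiv.norm_map, EuclideanSpace.norm_sq_eq]
    simp [Fin.sum_univ_two]
  let τ : E2 →L[ℝ] ℝ := (v 0 / L) • EuclideanSpace.proj 1 - (v 1 / L) • EuclideanSpace.proj 0
  let e (i : Fin 2) : E2 := EuclideanSpace.single i 1
  let Φ : E2 → E2 := fun z => (f z / L) • e 0 + τ z • e 1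
  let Φ' : E2 →L[ℝ] E2 := (L⁻¹ • fderiv ℝ f z₀).smulRight (e 0) + τ.smulRight (e 1)
  have hΦ : HasStrictFDerivAt Φ Φ' z₀ := by
    have h1 : HasStrictFDerivAt (fun z => f z / L) (L⁻¹ • fderiv ℝ f z₀) z₀ := by
      simpa [div_eq_inv_mul] using hf.const_mul L⁻¹
    exact (h1.smul_const (e 0)).add (τ.hasStrictFDerivAt.smul_const (e 1))
  have hΦ' (w : E2) : ‖Φ' w‖ = ‖w‖ := by
    rw [← sq_eq_sq₀ (norm_nonneg _) (norm_nonneg _), EuclideanSpace.norm_sq_eq,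
      EuclideanSpace.norm_sq_eq]
    simp [Fin.sum_univ_two, Φ', e, τ, hvw]
    field_simp
    linear_combination (w 0 ^ 2 + w 1 ^ 2) * hvL
  have hκ0 : (0 : ℝ) < κ := by exact_mod_cast zero_lt_one.trans hκ
  have hκ1 : (1 : ℝ) < κ := by exact_mod_cast hκ
  have hε : 0 < 1 - (κ : ℝ)⁻¹ := sub_pos.2 (inv_lt_one_of_one_lt₀ hκ1)
  have hev := hΦ.isLittleO.def hε
  rw [nhds_prod_eq] at hev
  obtain ⟨U, hU, hUU⟩ := (eventually_prod_self_iff (r := fun x y =>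
    ‖Φ x - Φ y - Φ' (x - y)‖ ≤ (1 - (κ : ℝ)⁻¹) * ‖x - y‖)).1 hev
  refine ⟨{z | z ∈ U}, hU, Φ, fun z => by simp [Φ, e], ?_, fun x hx y hy => ?_⟩
  · refine LipschitzOnWith.of_dist_le_mul fun x hx y hy => ?_
    have h := hUU x hx y hy
    have h1 := norm_le_norm_sub_add (Φ x - Φ y) (Φ' (x - y))
    rw [hΦ'] at h1
    rw [dist_eq_norm, dist_eq_norm]
    have : (1 - (κ : ℝ)⁻¹) + 1 ≤ κ := by
      have := mul_inv_cancel₀ hκ0.ne'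
      nlinarith [inv_pos.2 hκ0]
    nlinarith [norm_nonneg (x - y)]
  · have h := hUU x hx y hy
    have h1 := norm_le_norm_sub_add (Φ' (x - y)) (Φ x - Φ y)
    rw [hΦ', norm_sub_rev (Φ' (x - y))] at h1
    rw [dist_eq_norm, dist_eq_norm]
    have h2 : (κ : ℝ)⁻¹ * ‖x - y‖ ≤ ‖Φ x - Φ y‖ := by linarith
    rwa [inv_mul_le_iff₀ hκ0] at h2

theorem exists_nhds_levelLengthBound {f : E2 → ℝ} {z₀ : E2}
    (hf : HasStrictFDerivAt f (fderiv ℝ f z₀) z₀) (h0 : fderiv ℝ f z₀ ≠ 0) {κ : ℝ≥0}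
    (hκ : 1 < κ) : ∃ U ∈ 𝓝 z₀, ∀ A ⊆ U, MeasurableSet A →
      LevelLengthBound f A (κ ^ 3 * ENNReal.ofReal ‖fderiv ℝ f z₀‖ * volume A) := by
  obtain ⟨U, hU, Φ, hΦ0, hlip, hanti⟩ := exists_straightening hf h0 hκ
  refine ⟨U, hU, fun A hAU hA => ?_⟩
  set L := ‖fderiv ℝ f z₀‖
  have hL : 0 < L := norm_pos_iff.2 h0
  have hinj : InjOn Φ A := fun x hx y hy hxy => by
    have := hanti x (hAU hx) y (hAU hy)
    rw [hxy, dist_self, mul_zero] at this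
    exact dist_le_zero.1 this
  have hB : MeasurableSet (Φ '' A) :=
    hA.image_of_continuousOn_injOn (hlip.mono hAU).continuousOn hinj
  have hinv : LipschitzOnWith κ (Function.invFunOn Φ A) (Φ '' A) := by
    refine LipschitzOnWith.of_dist_le_mul ?_
    rintro _ ⟨x, hx, rfl⟩ _ ⟨y, hy, rfl⟩
    rw [hinj.leftInvOn_invFunOn hx, hinj.leftInvOn_invFunOn hy]
    exact hanti x (hAU hx) y (hAU hy)
  obtain ⟨hm, hint⟩ := measurable_hausdorffMeasure_slice hB
  refine ⟨fun r => κ * μH[1] (Φ '' A ∩ {z | z 0 = r / L}),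
    (hm.comp (measurable_id.div_const L)).const_mul _, fun r => ?_, ?_⟩
  · have hsub : A ∩ f ⁻¹' {r} ⊆ Function.invFunOn Φ A '' (Φ '' A ∩ {z | z 0 = r / L}) := by
      rintro x ⟨hx, rfl⟩
      exact ⟨Φ x, ⟨mem_image_of_mem _ hx, hΦ0 x⟩, hinj.leftInvOn_invFunOn hx⟩
    refine (measure_mono hsub).trans ?_
    simpa using (hinv.mono inter_subset_left).hausdorffMeasure_image_le zero_le_one
  · have hm' : Measurable fun r => μH[1] (Φ '' A ∩ {z | z 0 = r / L}) :=
      hm.comp (measurable_id.div_const L)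
    rw [lintegral_const_mul _ hm', lintegral_comp_div hm hL, hint]
    calc (κ : ℝ≥0∞) * (ENNReal.ofReal L * volume (Φ '' A))
        ≤ κ * (ENNReal.ofReal L * (κ ^ 2 * volume A)) := by
          gcongr
          exact (hlip.mono hAU).volume_image_le
      _ = _ := by ring

theorem exists_forall_dist_lt_imp_dist_le {f : E2 → ℝ} (hf : ContDiff ℝ 1 f) {s : Set E2}
    (hs : Bornology.IsBounded s) (hcrit : ∀ z ∈ s, fderiv ℝ f z = 0) {ε : ℝ≥0} (hε : 0 < ε) :
    ∃ δ > 0, ∀ x ∈ s, ∀ y, dist x y < δ → dist (f x) (f y) ≤ ε * dist x y := by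
  have hcont : Continuous (fderiv ℝ f) := hf.continuous_fderiv one_ne_zero
  have hunif := hs.isCompact_closure.uniformContinuousAt_of_continuousAt (fderiv ℝ f)
    (fun _ _ => hcont.continuousAt) (Metric.dist_mem_uniformity (NNReal.coe_pos.2 hε))
  obtain ⟨δ, hδ, h⟩ := Metric.mem_uniformity_dist.1 hunif
  refine ⟨δ, hδ, fun x hx y hxy => ?_⟩
  have hbound : ∀ w ∈ Metric.ball x δ, ‖fderiv ℝ f w‖ ≤ ε := fun w hw => by
    have := h (a := x) (b := w) (by rwa [dist_comm]) (subset_closure hx)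
    rw [mem_ofPred_eq, hcrit x hx, dist_zero_left] at this
    exact this.le
  rw [dist_eq_norm, dist_eq_norm]
  exact (convex_ball x δ).norm_image_sub_le_of_norm_fderiv_le
    (fun w _ => hf.differentiable one_ne_zero w) hbound (by rwa [Metric.mem_ball, dist_comm])
    (Metric.mem_ball_self hδ)

/-- A bounded planar set is covered by `(n + 1) ^ 2` sets of diameter `O((n + 1)⁻¹)`. -/
theorem exists_grid_cover {s : Set E2} (hs : Bornology.IsBounded s) :
    ∃ R : ℝ≥0, ∃ Q : (n : ℕ) → (Fin 2 → Fin (n + 1)) → Set E2,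
      (∀ n, s ⊆ ⋃ j, Q n j) ∧ ∀ n j, Metric.ediam (Q n j) ≤ R / (n + 1 : ℕ) := by
  obtain ⟨R, hR, hsR⟩ := hs.subset_ball_lt 0 0
  refine ⟨(4 * R).toNNReal, fun n j => {z | ∀ i, 2 * R / (n + 1) * j i ≤ z i + R ∧
    z i + R ≤ 2 * R / (n + 1) * (j i + 1)}, fun n z hz => ?_, fun n j => ?_⟩
  · have hzR (i : Fin 2) : |z i| < R :=
      (PiLp.norm_apply_le z i).trans_lt (mem_ball_zero_iff.1 (hsR hz))
    have hpos (i : Fin 2) : 0 ≤ (z i + R) / (2 * R / (n + 1)) := by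
      have := (abs_lt.1 (hzR i)).1
      have : 0 ≤ z i + R := by linarith
      positivity
    have hlt (i : Fin 2) : ⌊(z i + R) / (2 * R / (n + 1))⌋₊ < n + 1 := by
      rw [Nat.floor_lt (hpos i), div_lt_iff₀ (by positivity)]
      have := (abs_lt.1 (hzR i)).2
      push_cast
      rw [mul_div_cancel₀ _ (by positivity)]
      linarith
    refine mem_iUnion.2 ⟨fun i => ⟨_, hlt i⟩, fun i => ⟨?_, ?_⟩⟩
    · have := Nat.floor_le (hpos i)
      rwa [le_div_iff₀' (by positivity)] at this
    · have := (Nat.lt_floor_add_one ((z i + R) / (2 * R / (n + 1)))).le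
      rwa [div_le_iff₀' (by positivity)] at this
  · have hd : ((4 * R).toNNReal : ℝ≥0∞) / (n + 1 : ℕ) =
        ENNReal.ofReal (2 * (2 * R / (n + 1))) := by
      rw [show 2 * (2 * R / (n + 1)) = 4 * R / (n + 1 : ℕ) by push_cast; ring,
        ENNReal.ofReal_div_of_pos (by positivity), ENNReal.ofReal_natCast]
      rfl
    rw [hd]
    refine Metric.ediam_le_of_forall_dist_le fun z hz w hw => ?_
    have hi (i : Fin 2) : |z i - w i| ≤ 2 * R / (n + 1) := by
      have h1 := hz i
      have h2 := hw i
      rw [abs_le]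
      constructor <;> linarith
    rw [EuclideanSpace.dist_eq, Fin.sum_univ_two]
    refine Real.sqrt_le_iff.2 ⟨by positivity, ?_⟩
    rw [Real.dist_eq, Real.dist_eq]
    nlinarith [hi 0, hi 1, abs_nonneg (z 0 - w 0), abs_nonneg (z 1 - w 1),
      show 0 ≤ 2 * R / (n + 1) by positivity]

/-- The critical points of a `C¹` function do not contribute to the length of its level sets. -/
theorem levelLengthBound_of_fderiv_eq_zero {f : E2 → ℝ} (hf : ContDiff ℝ 1 f) {s : Set E2}
    (hs : Bornology.IsBounded s) (hcrit : ∀ z ∈ s, fderiv ℝ f z = 0) {c : ℝ≥0∞} (hc : c ≠ 0) :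
    LevelLengthBound f s c := by
  obtain ⟨R, Q, hcover, hdiam⟩ := exists_grid_cover hs
  obtain ⟨ε, hε, hεc⟩ := ENNReal.exists_nnreal_pos_mul_lt
    (ENNReal.pow_ne_top (n := 2) (ENNReal.coe_ne_top (r := R))) hc
  obtain ⟨δ, hδ, hLip⟩ := exists_forall_dist_lt_imp_dist_le hf hs hcrit hε
  let d (n : ℕ) : ℝ≥0∞ := R / (n + 1 : ℕ)
  have hd : Tendsto d atTop (𝓝 0) := by
    rw [← ENNReal.div_top (a := (R : ℝ≥0∞))]
    exact ENNReal.Tendsto.const_div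
      (ENNReal.tendsto_nat_nhds_top.comp (tendsto_add_atTop_nat 1)) (Or.inr ENNReal.coe_ne_top)
  let T (n : ℕ) (j : Fin 2 → Fin (n + 1)) : Set ℝ := toMeasurable volume (f '' (Q n j ∩ s))
  let g (n : ℕ) (r : ℝ) : ℝ≥0∞ := ∑ j, (T n j).indicator (fun _ => d n) r
  have hT (n j) : MeasurableSet (T n j) := measurableSet_toMeasurable _ _
  have hg (n) : Measurable (g n) :=
    Finset.measurable_sum _ fun j _ => measurable_const.indicator (hT n j)
  refine ⟨fun r => liminf (fun n => g n r) atTop, Measurable.liminf hg, fun r => ?_, ?_⟩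
  · refine (Measure.hausdorffMeasure_le_liminf_sum 1 (s ∩ f ⁻¹' {r}) d hd
      (fun n j => Q n j ∩ (s ∩ f ⁻¹' {r}))
      (.of_forall fun n j => (Metric.ediam_mono inter_subset_left).trans (hdiam n j))
      (.of_forall fun n => ?_)).trans ?_
    · rw [← iUnion_inter]
      exact subset_inter (inter_subset_left.trans (hcover n)) subset_rfl
    · refine liminf_le_liminf (.of_forall fun n => Finset.sum_le_sum fun j _ => ?_)
      rw [ENNReal.rpow_one]
      rcases (Q n j ∩ (s ∩ f ⁻¹' {r})).eq_empty_or_nonempty with h | ⟨z, hzQ, hzs, hzr⟩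
      · simp [h]
      · have : r ∈ T n j := subset_toMeasurable _ _ ⟨z, ⟨hzQ, hzs⟩, hzr⟩
        rw [indicator_of_mem this]
        exact (Metric.ediam_mono inter_subset_left).trans (hdiam n j)
  · refine (lintegral_liminf_le hg).trans ?_
    refine (liminf_le_of_frequently_le' (Eventually.frequently ?_)).trans hεc.le
    filter_upwards [hd.eventually_lt_const (ENNReal.ofReal_pos.2 hδ)] with n hn
    have hvol (j) : volume (T n j) ≤ ε * d n := by
      have hl : LipschitzOnWith ε f (Q n j ∩ s) :=
        LipschitzOnWith.of_dist_le_mul fun x hx y hy => hLip x hx.2 y <| by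
          rw [← ENNReal.ofReal_lt_ofReal_iff hδ, ← edist_dist]
          exact ((Metric.edist_le_ediam_of_mem hx.1 hy.1).trans (hdiam n j)).trans_lt hn
      rw [measure_toMeasurable]
      calc volume (f '' (Q n j ∩ s)) ≤ Metric.ediam (f '' (Q n j ∩ s)) := Real.volume_le_diam _
        _ ≤ ε * Metric.ediam (Q n j ∩ s) := by
          refine Metric.ediam_image_le_iff.2 fun x hx y hy => (hl hx hy).trans ?_
          gcongr
          exact Metric.edist_le_ediam_of_mem hx hy
        _ ≤ ε * d n := by
          gcongr
          exact (Metric.ediam_mono inter_subset_left).trans (hdiam n j)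
    calc ∫⁻ r, g n r = ∑ j, d n * volume (T n j) := by
          rw [lintegral_finsetSum _ fun j _ => measurable_const.indicator (hT n j)]
          simp_rw [lintegral_indicator_const (hT n _)]
      _ ≤ ∑ j : Fin 2 → Fin (n + 1), d n * (ε * d n) := by gcongr with j; exact hvol j
      _ = ε * (((n + 1 : ℕ) : ℝ≥0∞) * d n) ^ 2 := by
          simp only [Finset.sum_const, Finset.card_univ, Fintype.card_pi, Fintype.card_fin,
            Fin.prod_univ_two, nsmul_eq_mul, Nat.cast_mul]
          ring
      _ = ε * (R : ℝ≥0∞) ^ 2 := by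
          rw [ENNReal.mul_div_cancel (by simp) (ENNReal.natCast_ne_top _)]

theorem levelLengthBound_of_isCompact {f : E2 → ℝ} (hf : ContDiff ℝ 1 f) {K : Set E2}
    (hK : IsCompact K) {M : ℝ≥0∞} (hM : ∀ z ∈ K, ENNReal.ofReal ‖fderiv ℝ f z‖ ≤ M) {κ : ℝ≥0}
    (hκ : 1 < κ) {c : ℝ≥0∞} (hc : c ≠ 0) :
    LevelLengthBound f K (κ ^ 3 * M * volume K + c) := by
  have hcrit : LevelLengthBound f {z ∈ K | fderiv ℝ f z = 0} c :=
    levelLengthBound_of_fderiv_eq_zero hf (hK.isBounded.subset (sep_subset _ _))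
      (fun z hz => hz.2) hc
  set s : Set E2 := {z ∈ K | fderiv ℝ f z ≠ 0} with hs
  have hsK : s ⊆ K := sep_subset _ _
  have hsm : MeasurableSet s := hK.measurableSet.inter
    (isClosed_eq (hf.continuous_fderiv one_ne_zero) continuous_const).measurableSet.compl
  suffices h : LevelLengthBound f s (κ ^ 3 * M * volume K) by
    refine (h.union hcrit).mono (fun z hz => ?_) le_rfl
    by_cases h0 : fderiv ℝ f z = 0
    exacts [Or.inr ⟨hz, h0⟩, Or.inl ⟨hz, h0⟩]
  have hloc : ∀ z ∈ s, ∃ U, IsOpen U ∧ z ∈ U ∧ ∀ A ⊆ U, MeasurableSet A →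
      LevelLengthBound f A (κ ^ 3 * M * volume A) := fun z hz => by
    obtain ⟨V, hV, h⟩ := exists_nhds_levelLengthBound
      (hf.contDiffAt.hasStrictFDerivAt one_ne_zero : HasStrictFDerivAt f (fderiv ℝ f z) z) hz.2 hκ
    obtain ⟨U, hUV, hU, hzU⟩ := mem_nhds_iff.1 hV
    refine ⟨U, hU, hzU, fun A hA hAm => (h A (hA.trans hUV) hAm).mono subset_rfl ?_⟩
    gcongr
    exact hM z hz.1
  choose! U hUo hzU hU using hloc
  obtain ⟨t, hts, htc, hst⟩ := TopologicalSpace.countable_cover_nhdsWithin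
    fun z hz => mem_nhdsWithin_of_mem_nhds ((hUo z hz).mem_nhds (hzU z hz))
  rcases t.eq_empty_or_nonempty with rfl | hne
  · have : s = ∅ := by simpa [subset_empty_iff] using hst
    exact ⟨0, measurable_const, by simp [this], by simp⟩
  obtain ⟨u, rfl⟩ := htc.exists_eq_range hne
  have hus (n : ℕ) : u n ∈ s := hts (mem_range_self n)
  let A (n : ℕ) : Set E2 := disjointed (fun n => U (u n)) n ∩ s
  have hAm (n : ℕ) : MeasurableSet (A n) :=
    (MeasurableSet.disjointed (fun n => (hUo _ (hus n)).measurableSet) n).inter hsm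
  have hAs : ⋃ n, A n = s := by
    rw [← iUnion_inter, iUnion_disjointed, inter_eq_right]
    simpa using hst
  have hAd : Pairwise (Function.onFun Disjoint A) := fun m n hmn =>
    (disjoint_disjointed _ hmn).mono inter_subset_left inter_subset_left
  have h := LevelLengthBound.iUnion fun n => hU (u n) (hus n) (A n)
    (inter_subset_left.trans (disjointed_subset _ n)) (hAm n)
  rw [ENNReal.tsum_mul_left, ← measure_iUnion hAd hAm, hAs] at h
  refine h.mono subset_rfl ?_
  gcongr

theorem LevelLengthBound.iInf_le {f : E2 → ℝ} {a b : ℝ} {C : ℝ≥0∞}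
    (h : LevelLengthBound f (f ⁻¹' Icc a b) C) :
    ENNReal.ofReal (b - a) * (⨅ r ∈ Ioo a b, μH[1] (f ⁻¹' {r})) ≤ C := by
  obtain ⟨g, hg, hle, hint⟩ := h
  calc ENNReal.ofReal (b - a) * (⨅ r ∈ Ioo a b, μH[1] (f ⁻¹' {r}))
      = ∫⁻ _ in Ioo a b, ⨅ r ∈ Ioo a b, μH[1] (f ⁻¹' {r}) := by
        rw [setLIntegral_const, Real.volume_Ioo, mul_comm]
    _ ≤ ∫⁻ r in Ioo a b, g r := by
        refine setLIntegral_mono hg fun r hr => (iInf₂_le r hr).trans ((hle r).trans' ?_)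
        refine measure_mono (subset_inter ?_ subset_rfl)
        exact preimage_mono (singleton_subset_iff.2 (Ioo_subset_Icc_self hr))
    _ ≤ ∫⁻ r, g r := setLIntegral_le_lintegral _ _
    _ ≤ C := hint

/-- Coarea-type inequality: for `ω : ℝ² → ℝ` of class `C¹` with
`K = ω⁻¹([a,b])` compact,
`(b − a) · inf_{r ∈ (a,b)} H¹(ω⁻¹{r}) ≤ (sup_{z ∈ K} ‖∇ω(z)‖) · vol(K)`. -/
theorem stmt_10 (ω : E2 → ℝ) (hω : ContDiff ℝ 1 ω) (a b : ℝ) (hab : a < b)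
    (hK : IsCompact (ω ⁻¹' Set.Icc a b)) :
    ENNReal.ofReal (b - a) * (⨅ r ∈ Set.Ioo a b, μH[1] (ω ⁻¹' {r}))
      ≤ ENNReal.ofReal (⨆ z ∈ ω ⁻¹' Set.Icc a b, ‖gradient ω z‖)
        * volume (ω ⁻¹' Set.Icc a b) := by
  have hgrad (z : E2) : ‖gradient ω z‖ = ‖fderiv ℝ ω z‖ :=
    LinearIsometryEquiv.norm_map _ _
  simp_rw [hgrad]
  set K := ω ⁻¹' Icc a b
  set M := ⨆ z ∈ K, ‖fderiv ℝ ω z‖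
  obtain ⟨B, hB⟩ := (hK.image (hω.continuous_fderiv one_ne_zero).norm).bddAbove
  have hbdd : BddAbove (range fun z => ⨆ _ : z ∈ K, ‖fderiv ℝ ω z‖) := by
    refine ⟨max B 0, ?_⟩
    rintro _ ⟨z, rfl⟩
    by_cases hz : z ∈ K
    · simpa [hz] using Or.inl (hB (mem_image_of_mem _ hz))
    · simp [hz]
  have hM : ∀ z ∈ K, ENNReal.ofReal ‖fderiv ℝ ω z‖ ≤ ENNReal.ofReal M := fun z hz =>
    ENNReal.ofReal_le_ofReal <| by simpa [hz] using le_ciSup hbdd z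
  have key (κ : ℝ≥0) (hκ : 1 < κ) :
      ENNReal.ofReal (b - a) * (⨅ r ∈ Ioo a b, μH[1] (ω ⁻¹' {r})) ≤
        κ ^ 3 * (ENNReal.ofReal M * volume K) := by
    rw [← mul_assoc]
    exact ENNReal.le_of_forall_pos_le_add fun ε hε _ =>
      (levelLengthBound_of_isCompact hω hK hM hκ (ENNReal.coe_pos.2 hε).ne').iInf_le
  have hlim : Tendsto (fun κ : ℝ≥0 => (κ : ℝ≥0∞) ^ 3 * (ENNReal.ofReal M * volume K)) (𝓝[>] 1)
      (𝓝 (ENNReal.ofReal M * volume K)) := by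
    have h1 : Tendsto (fun κ : ℝ≥0 => ((κ ^ 3 : ℝ≥0) : ℝ≥0∞)) (𝓝[>] 1) (𝓝 ((1 ^ 3 : ℝ≥0))) :=
      ENNReal.tendsto_coe.2 (((continuous_pow 3).tendsto 1).mono_left nhdsWithin_le_nhds)
    have h2 := ENNReal.Tendsto.mul_const (b := ENNReal.ofReal M * volume K) h1
      (Or.inr (ENNReal.mul_ne_top ENNReal.ofReal_ne_top hK.measure_ne_top))
    simpa using h2
  exact ge_of_tendsto hlim (eventually_nhdsWithin_of_forall key)
end
end

section
/- Let ω₀ : ℝ² → ℝ be continuously differentiable, let a < b, and suppose K₀ := ω₀⁻¹([a,b]) is compact with 0 < vol(K₀). For each n ∈ ℕ let fₙ : ℝ² → ℝ² be a C¹ diffeomorphism preserving Lebesgue measure, and set ωₙ := ω₀ ∘ fₙ⁻¹. Suppose there are constants k > 0 and λ > 1 such that for every n and every r ∈ (a,b), H¹(ωₙ⁻¹({r})) ≥ k·λⁿ. Then for every n, sup_{z ∈ fₙ(K₀)} ‖∇ωₙ(z)‖ ≥ (b − a)·k·λⁿ / vol(K₀); in particular the sup norm of the gradient of the transported vorticity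 grows exponentially in n. -/
open MeasureTheory
open scoped ENNReal RealInnerProductSpace

noncomputable section

open Set Filter Topology Metric
open scoped NNReal

/-- Eilenberg's inequality. -/
theorem LipschitzOnWith.exists_measurable_hausdorffMeasure_fiber_le {X : Type*} [EMetricSpace X]
    [MeasurableSpace X] [BorelSpace X] {g : X → ℝ} {A : Set X} {ε : ℝ≥0}
    (hg : LipschitzOnWith ε g A) (hA : μH[2] A ≠ ∞) :
    ∃ F : ℝ → ℝ≥0∞, Measurable F ∧ (∀ r, μH[1] (A ∩ g ⁻¹' {r}) ≤ F r) ∧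
      ∫⁻ r, F r ≤ ε * μH[2] A := by
  have hcover (n : ℕ) : ∃ t : ℕ → Set X, A ⊆ ⋃ i, t i ∧
      (∀ i, ediam (t i) ≤ ((n : ℝ≥0∞) + 1)⁻¹) ∧
      ∑' i, ediam (t i) ^ (2 : ℝ) ≤ μH[2] A + ((n : ℝ≥0∞) + 1)⁻¹ := by
    have hpos : 0 < ((n : ℝ≥0∞) + 1)⁻¹ := ENNReal.inv_pos.2 (by finiteness)
    have hlt : μH[2] A < μH[2] A + ((n : ℝ≥0∞) + 1)⁻¹ := ENNReal.lt_add_right hA hpos.ne'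
    have hle := (le_iSup₂_of_le (f := fun (r : ℝ≥0∞) (_ : 0 < r) =>
      ⨅ (t : ℕ → Set X) (_ : A ⊆ ⋃ n, t n) (_ : ∀ n, ediam (t n) ≤ r),
          ∑' n, ⨆ _ : (t n).Nonempty, ediam (t n) ^ (2 : ℝ)) _ hpos le_rfl).trans
        (Measure.hausdorffMeasure_apply 2 A).ge
    obtain ⟨t, ht⟩ := iInf_lt_iff.1 (hle.trans_lt hlt)
    obtain ⟨htA, ht⟩ := iInf_lt_iff.1 ht
    obtain ⟨htd, ht⟩ := iInf_lt_iff.1 ht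
    refine ⟨t, htA, htd, le_trans (ENNReal.tsum_le_tsum fun i => ?_) ht.le⟩
    rcases (t i).eq_empty_or_nonempty with h | h
    · simp [h]
    · simp [h]
  choose t htA htd hts using hcover
  have htend : Tendsto (fun n : ℕ => ((n : ℝ≥0∞) + 1)⁻¹) atTop (𝓝 0) := by
    have := (tendsto_add_atTop_iff_nat 1).2 ENNReal.tendsto_inv_nat_nhds_zero
    simpa using this
  let V (n i : ℕ) : Set ℝ := toMeasurable volume (g '' (t n i ∩ A))
  have hVm (n i : ℕ) : MeasurableSet (V n i) := measurableSet_toMeasurable _ _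
  let G (n i : ℕ) : ℝ → ℝ≥0∞ := (V n i).indicator fun _ => ediam (t n i)
  have hGm (n i : ℕ) : Measurable (G n i) := measurable_const.indicator (hVm n i)
  have hSm (n : ℕ) : Measurable fun r => ∑' i, G n i r := Measurable.tsum (hGm n)
  refine ⟨fun r => liminf (fun n => ∑' i, G n i r) atTop, .liminf hSm, fun r => ?_, ?_⟩
  · refine (Measure.hausdorffMeasure_le_liminf_tsum 1 _ _ htend
      (fun n i => t n i ∩ (A ∩ g ⁻¹' {r})) ?_ ?_).trans ?_
    · exact .of_forall fun n i => (ediam_mono inter_subset_left).trans (htd n i)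
    · refine .of_forall fun n x hx => ?_
      obtain ⟨i, hi⟩ := mem_iUnion.1 (htA n hx.1)
      exact mem_iUnion.2 ⟨i, hi, hx⟩
    · refine liminf_le_liminf (.of_forall fun n => ENNReal.tsum_le_tsum fun i => ?_)
      rw [ENNReal.rpow_one]
      by_cases hr : r ∈ V n i
      · simpa [G, hr] using ediam_mono inter_subset_left
      · have : t n i ∩ (A ∩ g ⁻¹' {r}) = ∅ := by
          refine eq_empty_of_forall_notMem fun x hx => hr (subset_toMeasurable _ _ ?_)
          exact ⟨x, ⟨hx.1, hx.2.1⟩, hx.2.2⟩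
        simp [this]
  · refine (lintegral_liminf_le hSm).trans ?_
    have hint (n : ℕ) :
        ∫⁻ r, ∑' i, G n i r ≤ ε * (μH[2] A + ((n : ℝ≥0∞) + 1)⁻¹) := by
      rw [lintegral_tsum fun i => (hGm n i).aemeasurable]
      refine le_trans ?_ (mul_le_mul_right (hts n) _)
      rw [← ENNReal.tsum_mul_left]
      refine ENNReal.tsum_le_tsum fun i => ?_
      have hV : volume (V n i) ≤ ε * ediam (t n i) := by
        rw [measure_toMeasurable]
        refine (Real.volume_le_diam _).trans ?_
        refine (((hg.mono inter_subset_right).holderOnWith).ediam_image_le).trans ?_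
        rw [NNReal.coe_one, ENNReal.rpow_one]
        gcongr
        exact inter_subset_left
      rw [lintegral_indicator_const (hVm n i), ENNReal.rpow_two]
      calc _ ≤ ediam (t n i) * (ε * ediam (t n i)) := by gcongr
        _ = _ := by ring
    refine (liminf_le_liminf (.of_forall hint)).trans (Tendsto.liminf_eq ?_).le
    have := ENNReal.Tendsto.const_mul (a := (ε : ℝ≥0∞)) (htend.const_add (μH[2] A))
      (.inr ENNReal.coe_ne_top)
    simpa using this

/-- `g` satisfies the coarea inequality on `A` with constant `c`; the measurable majorant is there
because lengths of fibers need not be measurable in the value of `g`. -/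
def HasCoareaBound (g : E2 → ℝ) (c : ℝ≥0∞) (A : Set E2) : Prop :=
  ∃ F : ℝ → ℝ≥0∞, Measurable F ∧ (∀ r, μH[1] (A ∩ g ⁻¹' {r}) ≤ F r) ∧ ∫⁻ r, F r ≤ c * volume A

theorem HasCoareaBound.union {g : E2 → ℝ} {c : ℝ≥0∞} {A B : Set E2} (hA : HasCoareaBound g c A)
    (hB : HasCoareaBound g c B) (hAB : Disjoint A B) (hBm : MeasurableSet B) :
    HasCoareaBound g c (A ∪ B) := by
  obtain ⟨F, hF, hFA, hFi⟩ := hA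
  obtain ⟨G, hG, hGB, hGi⟩ := hB
  refine ⟨F + G, hF.add hG, fun r => ?_, ?_⟩
  · rw [union_inter_distrib_right]
    exact (measure_union_le _ _).trans (add_le_add (hFA r) (hGB r))
  · rw [measure_union hAB hBm, mul_add]
    exact (lintegral_add_left hF G).le.trans (add_le_add hFi hGi)

theorem exists_hausdorffMeasure_two_le_mul_volume :
    ∃ C : ℝ≥0, ∀ A : Set E2, μH[2] A ≤ C * volume A := by
  let e := PiLp.continuousLinearEquiv 2 ℝ (fun _ : Fin 2 => ℝ)
  refine ⟨‖(e.symm : (Fin 2 → ℝ) →L[ℝ] E2)‖₊ ^ 2, fun A => ?_⟩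
  have h := (e.symm : (Fin 2 → ℝ) →L[ℝ] E2).lipschitz.hausdorffMeasure_image_le
    (d := 2) zero_le_two (e '' A)
  have h1 : (e.symm : (Fin 2 → ℝ) →L[ℝ] E2) '' (e '' A) = A := by
    simp [image_image]
  have h2 : μH[2] (e '' A) = volume A := by
    have h3 : (μH[2] : Measure (Fin 2 → ℝ)) = volume := by
      simpa using hausdorffMeasure_pi_real (ι := Fin 2)
    have h4 : e '' A = (MeasurableEquiv.toLp 2 (Fin 2 → ℝ)) ⁻¹' A := by
      ext x
      constructor
      · rintro ⟨y, hy, rfl⟩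
        exact hy
      · intro hx
        exact ⟨_, hx, rfl⟩
    rw [h3, h4, (PiLp.volume_preserving_toLp (Fin 2)).measure_preimage_equiv]
  rw [h1, h2] at h
  simpa using h

theorem AntilipschitzWith.hausdorffMeasure_le_mul_image_of_domRestrict {X Y : Type*} [EMetricSpace X]
    [MeasurableSpace X] [BorelSpace X] [EMetricSpace Y] [MeasurableSpace Y] [BorelSpace Y]
    {K : ℝ≥0} {S : Set X} {W : X → Y} (h : AntilipschitzWith K (S.domRestrict W)) {d : ℝ}
    (hd : 0 ≤ d) : μH[d] S ≤ (K : ℝ≥0∞) ^ d * μH[d] (W '' S) := by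
  have h1 := h.le_hausdorffMeasure_image hd univ
  have h2 := (isometry_subtype_coe (s := S)).hausdorffMeasure_image (d := d) (.inl hd) univ
  rw [image_univ, Subtype.range_coe] at h2
  rwa [← h2, image_univ, range_domRestrict] at h1

theorem exists_open_hasCoareaBound_of_hasStrictFDerivAt_zero {g : E2 → ℝ} {p : E2}
    (hg : HasStrictFDerivAt g (0 : E2 →L[ℝ] ℝ) p) {c : ℝ≥0} (hc : 0 < c) :
    ∃ U, IsOpen U ∧ p ∈ U ∧ ∀ A ⊆ U, HasCoareaBound g c A := by
  obtain ⟨C, hC⟩ := exists_hausdorffMeasure_two_le_mul_volume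
  obtain ⟨s, hs, hLip⟩ := hg.exists_lipschitzOnWith_of_nnnorm_lt (c / (C + 1)) (by
    rw [nnnorm_zero]; positivity)
  obtain ⟨U, hUs, hUo, hpU⟩ := _root_.mem_nhds_iff.1 (inter_mem hs (ball_mem_nhds p one_pos))
  refine ⟨U, hUo, hpU, fun A hA => ?_⟩
  have hAs := hA.trans hUs
  have hfin : volume A ≠ ∞ :=
    measure_ne_top_of_subset (hAs.trans inter_subset_right) measure_ball_lt_top.ne
  obtain ⟨F, hF, hFA, hFi⟩ := (hLip.mono
    (hAs.trans inter_subset_left)).exists_measurable_hausdorffMeasure_fiber_le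
    ((hC A).trans_lt (by finiteness)).ne
  refine ⟨F, hF, hFA, hFi.trans ?_⟩
  calc ((c / (C + 1) : ℝ≥0) : ℝ≥0∞) * μH[2] A
      ≤ ((c / (C + 1) : ℝ≥0) : ℝ≥0∞) * (C * volume A) := by gcongr; exact hC A
    _ = ((c / (C + 1) * C : ℝ≥0) : ℝ≥0∞) * volume A := by push_cast; ring
    _ ≤ c * volume A := by
        gcongr
        rw [div_mul_eq_mul_div, div_le_iff₀ (by positivity)]
        gcongr
        exact le_self_add

theorem exists_measurable_volume_fiber (B : Set E2) :
    ∃ F : ℝ → ℝ≥0∞, Measurable F ∧ (∀ r, volume {s : ℝ | !₂[r, s] ∈ B} ≤ F r) ∧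
      ∫⁻ r, F r = volume B := by
  let e : E2 ≃ᵐ ℝ × ℝ := (MeasurableEquiv.toLp 2 (Fin 2 → ℝ)).symm.trans MeasurableEquiv.finTwoArrow
  have he : MeasurePreserving e :=
    (volume_preserving_finTwoArrow ℝ).comp
      (EuclideanSpace.volume_preserving_symm_measurableEquiv_toLp (Fin 2))
  have hB : MeasurableSet (e.symm ⁻¹' toMeasurable volume B) :=
    e.symm.measurable (measurableSet_toMeasurable _ _)
  refine ⟨fun r => volume (Prod.mk r ⁻¹' (e.symm ⁻¹' toMeasurable volume B)),
    measurable_measure_prodMk_left hB, fun r => measure_mono fun s hs =>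
      subset_toMeasurable _ _ hs, ?_⟩
  rw [← Measure.prod_apply hB, ← Measure.volume_eq_prod, (he.symm e).measure_preimage_equiv,
    measure_toMeasurable]

theorem exists_open_hasCoareaBound_of_hasStrictFDerivAt {g : E2 → ℝ} {p v : E2}
    (hg : HasStrictFDerivAt g (innerSL ℝ v) p) (hv : v ≠ 0) {c : ℝ≥0} (hc : ‖v‖ < c) :
    ∃ U, IsOpen U ∧ p ∈ U ∧ ∀ A ⊆ U, HasCoareaBound g c A := by
  obtain ⟨m, hvm, hmc⟩ : ∃ m : ℝ≥0, ‖v‖₊ < m ∧ m < c := exists_between hc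
  have hN : 0 < ‖v‖ := norm_pos_iff.2 hv
  have hm : 0 < m := hvm.bot_lt
  have hcpos : 0 < c := hm.trans hmc
  have hN2 : ‖v‖ ^ 2 = v 0 ^ 2 + v 1 ^ 2 := by
    rw [EuclideanSpace.real_norm_sq_eq, Fin.sum_univ_two]
  let w : E2 := !₂[-v 1 / ‖v‖, v 0 / ‖v‖]
  let Φ : E2 → E2 := fun x =>
    g x • EuclideanSpace.single 0 (1 : ℝ) + innerSL ℝ w x • EuclideanSpace.single 1 (1 : ℝ)
  let L : E2 →L[ℝ] E2 := (innerSL ℝ v).smulRight (EuclideanSpace.single 0 (1 : ℝ)) +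
    (innerSL ℝ w).smulRight (EuclideanSpace.single 1 (1 : ℝ))
  have hΦ : HasStrictFDerivAt Φ L p :=
    (hg.smul_const _).add ((innerSL ℝ w).hasStrictFDerivAt.smul_const _)
  have hdet : L.det = ‖v‖ := by
    rw [ContinuousLinearMap.det,
      ← LinearMap.det_toMatrix (EuclideanSpace.basisFun (Fin 2) ℝ).toBasis, Matrix.det_fin_two]
    simp [LinearMap.toMatrix_apply, L, w, PiLp.inner_apply]
    field_simp
    linarith
  obtain ⟨δ, hδ, hδpos⟩ := ((addHaar_image_le_mul_of_det_lt volume L (m := m) (by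
    rw [hdet, abs_of_pos hN, ofReal_norm]; exact ENNReal.coe_lt_coe.2 hvm)).and
      self_mem_nhdsWithin).exists
  obtain ⟨s, hs, hsΦ⟩ := hΦ.approximates_deriv_on_nhds (c := δ) (.inr hδpos)
  have hη : 0 < ‖v‖₊ * (1 - m / c) := by
    have : m / c < 1 := (div_lt_one hcpos).2 hmc
    exact mul_pos hN (tsub_pos_of_lt this)
  have hη' : ((‖v‖₊ * (1 - m / c) : ℝ≥0) : ℝ) = ‖v‖ * (1 - m / c) := by
    rw [NNReal.coe_mul, NNReal.coe_sub ((div_lt_one hcpos).2 hmc).le]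
    simp
  obtain ⟨t, ht, htg⟩ := hg.approximates_deriv_on_nhds (.inr hη)
  obtain ⟨U, hU, hUo, hpU⟩ := _root_.mem_nhds_iff.1 (inter_mem hs ht)
  have hanti (r : ℝ) {A : Set E2} (hA : A ⊆ U) :
      AntilipschitzWith (c / m) ((A ∩ g ⁻¹' {r}).domRestrict (innerSL ℝ w)) := by
    refine .of_le_mul_dist fun x y => ?_
    obtain ⟨x, hxA, hx⟩ := x
    obtain ⟨y, hyA, hy⟩ := y
    have h := htg x (hU (hA hxA)).2 y (hU (hA hyA)).2
    rw [hη', show g x = r from hx, show g y = r from hy, sub_self, zero_sub, norm_neg] at h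
    simp only [domRestrict_apply, Subtype.dist_eq, dist_eq_norm, ← map_sub]
    push_cast
    generalize x - y = z at h ⊢
    have hz : ‖z‖ ^ 2 = z 0 ^ 2 + z 1 ^ 2 := by
      rw [EuclideanSpace.real_norm_sq_eq, Fin.sum_univ_two]
    have hpyth : (‖z‖ * ‖v‖) ^ 2 = (‖innerSL ℝ v z‖) ^ 2 + (‖v‖ * ‖innerSL ℝ w z‖) ^ 2 := by
      simp only [Real.norm_eq_abs, mul_pow, sq_abs, innerSL_apply_apply, PiLp.inner_apply, w,
        Fin.sum_univ_two]
      simp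
      field_simp
      rw [hz, hN2]
      ring
    have hsum : ‖z‖ * ‖v‖ ≤ ‖innerSL ℝ v z‖ + ‖v‖ * ‖innerSL ℝ w z‖ := by
      refine abs_le_of_sq_le_sq' ?_ (by positivity) |>.2
      rw [hpyth]
      nlinarith [mul_nonneg (norm_nonneg (innerSL ℝ v z))
        (mul_nonneg hN.le (norm_nonneg (innerSL ℝ w z)))]
    have hm' : (0 : ℝ) < m := hm
    have hc' : (0 : ℝ) < c := hcpos
    have h3 : ‖v‖ * (m / c * ‖z‖) ≤ ‖v‖ * ‖innerSL ℝ w z‖ := by linarith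
    have h4 := le_of_mul_le_mul_left h3 hN
    rw [div_mul_eq_mul_div, div_le_iff₀ hc'] at h4
    rw [div_mul_eq_mul_div, le_div_iff₀ hm']
    linarith
  refine ⟨U, hUo, hpU, fun A hA => ?_⟩
  obtain ⟨F, hF, hFB, hFi⟩ := exists_measurable_volume_fiber (Φ '' A)
  refine ⟨fun r => (c / m : ℝ≥0) * F r, hF.const_mul _, fun r => ?_, ?_⟩
  · refine (hanti r hA).hausdorffMeasure_le_mul_image_of_domRestrict zero_le_one |>.trans ?_
    rw [ENNReal.rpow_one, hausdorffMeasure_real]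
    refine mul_le_mul_right ?_ _
    refine (measure_mono ?_).trans (hFB r)
    rintro _ ⟨x, ⟨hxA, hx⟩, rfl⟩
    refine ⟨x, hxA, ?_⟩
    have hx : g x = r := hx
    ext i
    fin_cases i <;> simp [Φ, hx]
  · rw [lintegral_const_mul _ hF, hFi]
    calc _ ≤ ((c / m : ℝ≥0) : ℝ≥0∞) * (m * volume A) := by
          gcongr
          exact hδ A Φ (hsΦ.mono_set (hA.trans (hU.trans inter_subset_left)))
      _ = ((c / m * m : ℝ≥0) : ℝ≥0∞) * volume A := by push_cast; ring
      _ = c * volume A := by rw [div_mul_cancel₀ _ hm.ne']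

theorem IsCompact.hasCoareaBound {g : E2 → ℝ} (hg : ContDiff ℝ 1 g) {K : Set E2}
    (hK : IsCompact K) {c : ℝ≥0} (hc : ∀ x ∈ K, ‖gradient g x‖ < c) : HasCoareaBound g c K := by
  suffices h : ∃ T, K ⊆ T ∧ IsOpen T ∧ ∀ A ⊆ T, MeasurableSet A → HasCoareaBound g c A by
    obtain ⟨T, hKT, -, hT⟩ := h
    exact hT K hKT hK.measurableSet
  refine hK.induction_on (p := fun S => ∃ T, S ⊆ T ∧ IsOpen T ∧
    ∀ A ⊆ T, MeasurableSet A → HasCoareaBound g c A) ?_ ?_ ?_ ?_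
  · refine ⟨∅, Subset.rfl, isOpen_empty, fun A hA _ => ⟨0, measurable_zero, ?_, by simp⟩⟩
    simp [subset_empty_iff.1 hA]
  · rintro s t hst ⟨T, htT, hT⟩
    exact ⟨T, hst.trans htT, hT⟩
  · rintro s t ⟨S, hsS, hSo, hS⟩ ⟨T, htT, hTo, hT⟩
    refine ⟨S ∪ T, union_subset_union hsS htT, hSo.union hTo, fun A hA hAm => ?_⟩
    rw [← inter_union_sdiff A S]
    have hm := hAm.diff hSo.measurableSet
    exact (hS _ inter_subset_right (hAm.inter hSo.measurableSet)).union
      (hT _ (sdiff_subset_iff.2 hA) hm) disjoint_sdiff_inter.symm hm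
  · intro p hp
    have hs : HasStrictFDerivAt g (innerSL ℝ (gradient g p)) p := by
      have := hg.contDiffAt.hasStrictFDerivAt (x := p) one_ne_zero
      rwa [← toDual_gradient] at this
    obtain ⟨U, hUo, hpU, hU⟩ : ∃ U, IsOpen U ∧ p ∈ U ∧ ∀ A ⊆ U, HasCoareaBound g c A := by
      by_cases h0 : gradient g p = 0
      · rw [h0, map_zero] at hs
        exact exists_open_hasCoareaBound_of_hasStrictFDerivAt_zero hs
          ((norm_nonneg _).trans_lt (hc p hp))
      · exact exists_open_hasCoareaBound_of_hasStrictFDerivAt hs h0 (hc p hp)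
    exact ⟨U, mem_nhdsWithin_of_mem_nhds (hUo.mem_nhds hpU), U, Subset.rfl, hUo,
      fun A hA _ => hU A hA⟩

/-- If all fibers of `g` over `(a, b)` have length at least `l`, the coarea inequality bounds the
gradient of `g` on `g⁻¹[a, b]` from below. -/
theorem mul_length_le_mul_volume_of_norm_gradient_le {g : E2 → ℝ} (hg : ContDiff ℝ 1 g) {a b : ℝ}
    (hab : a ≤ b) (hK : IsCompact (g ⁻¹' Icc a b)) {l M : ℝ} (hl : 0 ≤ l) (hM : 0 ≤ M)
    (hlen : ∀ r ∈ Ioo a b, ENNReal.ofReal l ≤ μH[1] (g ⁻¹' {r}))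
    (hgrad : ∀ x ∈ g ⁻¹' Icc a b, ‖gradient g x‖ ≤ M) :
    (b - a) * l ≤ M * (volume (g ⁻¹' Icc a b)).toReal := by
  suffices h : ∀ c > M, (b - a) * l ≤ c * (volume (g ⁻¹' Icc a b)).toReal by
    refine ge_of_tendsto (f := fun c => c * (volume (g ⁻¹' Icc a b)).toReal) (x := 𝓝[>] M)
      (((continuous_id.mul continuous_const).tendsto M).mono_left nhdsWithin_le_nhds) ?_
    exact eventually_nhdsWithin_of_forall h
  intro c hc
  lift c to ℝ≥0 using hM.trans hc.le
  obtain ⟨F, -, hFA, hFi⟩ := hK.hasCoareaBound hg fun x hx => (hgrad x hx).trans_lt hc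
  have h1 : ENNReal.ofReal l * ENNReal.ofReal (b - a) ≤ c * volume (g ⁻¹' Icc a b) := by
    rw [← Real.volume_Ioo, ← setLIntegral_const]
    refine (setLIntegral_mono' measurableSet_Ioo fun r hr => ?_).trans
      ((setLIntegral_le_lintegral _ F).trans hFi)
    have h2 : g ⁻¹' Icc a b ∩ g ⁻¹' {r} = g ⁻¹' {r} :=
      inter_eq_right.2 (preimage_mono (singleton_subset_iff.2 (Ioo_subset_Icc_self hr)))
    exact (hlen r hr).trans (h2 ▸ hFA r)
  have h2 := ENNReal.toReal_mono (ENNReal.mul_ne_top ENNReal.coe_ne_top hK.measure_ne_top) h1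
  rwa [ENNReal.toReal_mul, ENNReal.toReal_mul, ENNReal.toReal_ofReal hl,
    ENNReal.toReal_ofReal (sub_nonneg.2 hab), ENNReal.coe_toReal, mul_comm] at h2

/-- Quantitative core of Theorem 7: if the transported vorticity
`ωₙ = ω₀ ∘ fₙ⁻¹` under area-preserving `C¹` diffeomorphisms `fₙ` has all its
level sets `ωₙ⁻¹{r}`, `r ∈ (a,b)`, of length at least `k·λⁿ`, then
`sup_{z ∈ fₙ(K₀)} ‖∇ωₙ(z)‖ ≥ (b − a)·k·λⁿ / vol(K₀)`. -/
theorem stmt_11 (ω₀ : E2 → ℝ) (hω : ContDiff ℝ 1 ω₀) (a b : ℝ) (hab : a < b)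
    (hK : IsCompact (ω₀ ⁻¹' Set.Icc a b))
    (hvol : 0 < volume (ω₀ ⁻¹' Set.Icc a b))
    (f : ℕ → E2 ≃ E2)
    (hf : ∀ n, ContDiff ℝ 1 ⇑(f n)) (hf' : ∀ n, ContDiff ℝ 1 ⇑(f n).symm)
    (hmp : ∀ n, MeasurePreserving ⇑(f n) volume volume)
    (k lam : ℝ) (hk : 0 < k) (hlam : 1 < lam)
    (hlen : ∀ n, ∀ r ∈ Set.Ioo a b,
      ENNReal.ofReal (k * lam ^ n) ≤ μH[1] ((ω₀ ∘ ⇑(f n).symm) ⁻¹' {r})) :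
    ∀ n, (b - a) * k * lam ^ n / (volume (ω₀ ⁻¹' Set.Icc a b)).toReal
      ≤ ⨆ z ∈ ⇑(f n) '' (ω₀ ⁻¹' Set.Icc a b),
          ‖gradient (ω₀ ∘ ⇑(f n).symm) z‖ := by
  intro n
  have himage : f n '' (ω₀ ⁻¹' Icc a b) = (ω₀ ∘ (f n).symm) ⁻¹' Icc a b := by
    rw [preimage_comp, (f n).image_eq_preimage_symm]
  have hg : ContDiff ℝ 1 (ω₀ ∘ (f n).symm) := hω.comp (hf' n)
  have hK' := hK.image (hf n).continuous
  have hvol' : volume (f n '' (ω₀ ⁻¹' Icc a b)) = volume (ω₀ ⁻¹' Icc a b) := by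
    rw [← (hmp n).measure_preimage hK'.measurableSet.nullMeasurableSet,
      preimage_image_eq _ (f n).injective]
  have hcont : Continuous fun z => ‖gradient (ω₀ ∘ (f n).symm) z‖ :=
    ((InnerProductSpace.toDual ℝ E2).symm.continuous.comp (hg.continuous_fderiv one_ne_zero)).norm
  obtain ⟨C, hC⟩ := hK'.bddAbove_image hcont.continuousOn
  have hbdd : BddAbove (range fun z => ⨆ (_ : z ∈ f n '' (ω₀ ⁻¹' Icc a b)),
      ‖gradient (ω₀ ∘ (f n).symm) z‖) := by
    refine ⟨max C 0, ?_⟩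
    rintro _ ⟨z, rfl⟩
    exact Real.iSup_le (fun hz => (hC (mem_image_of_mem _ hz)).trans (le_max_left _ _))
      (le_max_right _ _)
  rw [div_le_iff₀ (ENNReal.toReal_pos hvol.ne' hK.measure_ne_top), mul_assoc, ← hvol']
  rw [himage] at hK' hbdd ⊢
  refine mul_length_le_mul_volume_of_norm_gradient_le hg hab.le hK' (by positivity)
    (Real.iSup_nonneg fun z => Real.iSup_nonneg fun _ => norm_nonneg _) (hlen n) fun z hz => ?_
  refine le_trans ?_ (le_ciSup hbdd z)
  rw [ciSup_pos hz]
end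
end

section
/- Let f : ℝ² → ℝ² be a bijection and ω : ℝ² → ℝ a continuous function with ω ∘ f = ω. Let x, p, q ∈ ℝ², and suppose there exist curves γ₁, γ₂ : ℝ → ℝ² with γ₁(0) = γ₂(0) = x, each differentiable at 0 with derivatives γ₁'(0), γ₂'(0) linearly independent, such that for every τ ∈ ℝ the forward iterates fⁿ(γ₁(τ)) converge to p as n → ∞ and the backward iterates (f⁻¹)ⁿ(γ₂(τ)) converge to q as n → ∞. If ω is differentiable at x, then x is a critical point of ω: the derivative of ω at x is zero. -/
open MeasureTheory
open scoped ENNReal RealInnerProductSpace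

noncomputable section

/-- A continuous function invariant under `g` takes the value `ω p` at every point whose forward
orbit converges to `p`. -/
theorem eq_of_comp_eq_of_tendsto_iterate {X Y : Type*} [TopologicalSpace X] [TopologicalSpace Y]
    [T2Space Y] {g : X → X} {ω : X → Y} {y p : X} (hω : ContinuousAt ω p)
    (hinv : ∀ z, ω (g z) = ω z)
    (h : Filter.Tendsto (fun n => g^[n] y) Filter.atTop (nhds p)) : ω y = ω p := by
  have hconst : ∀ n, ω (g^[n] y) = ω y := fun n => by
    induction n with
    | zero => rfl
    | succ n ih => rw [Function.iterate_succ_apply', hinv, ih]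
  have hlim := hω.tendsto.comp h
  simp only [Function.comp_def, hconst] at hlim
  exact tendsto_nhds_unique tendsto_const_nhds hlim

/-- If `ω` is constant along a curve, then its derivative vanishes on the velocity of the curve. -/
theorem fderiv_apply_eq_zero_of_const_along {E F : Type*} [NormedAddCommGroup E]
    [NormedSpace ℝ E] [NormedAddCommGroup F] [NormedSpace ℝ F] {ω : E → F} {γ : ℝ → E} {v : E}
    {t : ℝ} {c : F} (hω : DifferentiableAt ℝ ω (γ t)) (hγ : HasDerivAt γ v t)
    (hc : ∀ τ, ω (γ τ) = c) : fderiv ℝ ω (γ t) v = 0 := by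
  have h := hω.hasFDerivAt.comp_hasDerivAt t hγ
  rw [show ω ∘ γ = fun _ => c from funext hc] at h
  exact h.unique (hasDerivAt_const t c)

/-- Heart of Proposition 4: a continuous function invariant under a bijection
`f` has a critical point at a transverse intersection `x` of a curve attracted
to `p` under forward iteration and a curve attracted to `q` under backward
iteration, provided the function is differentiable at `x`. -/
theorem stmt_12 (f : E2 ≃ E2) (ω : E2 → ℝ) (hω : Continuous ω)
    (hinv : ∀ z, ω (f z) = ω z)
    (x p q : E2) (γ₁ γ₂ : ℝ → E2) (v₁ v₂ : E2)
    (h10 : γ₁ 0 = x) (h20 : γ₂ 0 = x)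
    (hd1 : HasDerivAt γ₁ v₁ 0) (hd2 : HasDerivAt γ₂ v₂ 0)
    (hli : LinearIndependent ℝ ![v₁, v₂])
    (hp : ∀ τ : ℝ, Filter.Tendsto (fun n => (⇑f)^[n] (γ₁ τ)) Filter.atTop (nhds p))
    (hq : ∀ τ : ℝ, Filter.Tendsto (fun n => (⇑f.symm)^[n] (γ₂ τ)) Filter.atTop (nhds q))
    (hdiff : DifferentiableAt ℝ ω x) :
    fderiv ℝ ω x = 0 := by
  have hinv' : ∀ z, ω (f.symm z) = ω z := fun z => by rw [← hinv, f.apply_symm_apply]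
  have h1 : fderiv ℝ ω x v₁ = 0 := by
    subst h10
    exact fderiv_apply_eq_zero_of_const_along hdiff hd1 fun τ =>
      eq_of_comp_eq_of_tendsto_iterate hω.continuousAt hinv (hp τ)
  have h2 : fderiv ℝ ω x v₂ = 0 := by
    subst h20
    exact fderiv_apply_eq_zero_of_const_along hdiff hd2 fun τ =>
      eq_of_comp_eq_of_tendsto_iterate hω.continuousAt hinv' (hq τ)
  have hspan := hli.span_eq_top_of_card_eq_finrank' (by simp)
  refine ContinuousLinearMap.coe_injective (LinearMap.ext_on_range hspan fun i => ?_)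
  fin_cases i
  · simpa using h1
  · simpa using h2
end
end
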